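/- Let (V, V₊, v) and (W, W₊, w) be complete order unit spaces with open cones C := V₊° and D := W₊°, and let Φ: C → D be a gauge-reversing bijection. Then Φ is analytic: at every point x ∈ C, the map Φ (viewed as a map between the Banach spaces (V, ‖·‖_v) and (W, ‖·‖_w)) admits a convergent power series expansion, i.e. there exist r > 0 and continuous homogeneous polynomial maps c_k: V → W of degree k (k ≥ 0), given by continuous symmetric k-linear maps with limsup_k ‖c̄_k‖^{1/k} ≤ r⁻¹, such that Φ(x + h) = Σ_{k=0}^∞ c_k(h) for all h ∈ V with ‖h‖_v < r. -/

import Mathlib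

open scoped Topology

section Defs

/-- `(V, P, v)` is an order unit space: `P` is a proper cone, the induced order is
archimedean, `v` is an order unit, and the norm of `V` is the order unit norm. -/
structure IsOrderUnitSpace (V : Type*) [NormedAddCommGroup V] [NormedSpace ℝ V]
    (P : Set V) (v : V) : Prop where
  add_mem : ∀ x ∈ P, ∀ y ∈ P, x + y ∈ P
  smul_mem : ∀ r : ℝ, 0 ≤ r → ∀ x ∈ P, r • x ∈ P
  proper : ∀ x : V, x ∈ P → -x ∈ P → x = 0
  archimedean : ∀ x b : V, (∀ r : ℝ, 0 ≤ r → b - r • x ∈ P) → -x ∈ P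
  unit_mem : v ∈ P
  unit_order : ∀ x : V, ∃ r : ℝ, 0 < r ∧ r • v - x ∈ P
  norm_eq : ∀ x : V, ‖x‖ = sInf {r : ℝ | 0 ≤ r ∧ x + r • v ∈ P ∧ r • v - x ∈ P}

variable {V : Type*} [NormedAddCommGroup V] [NormedSpace ℝ V]
variable {W : Type*} [NormedAddCommGroup W] [NormedSpace ℝ W]

/-- The open cone (norm interior of the cone `P`) of an order unit space. -/
def openCone (P : Set V) (v : V) : Set V := {x | ∃ ε : ℝ, 0 < ε ∧ x - ε • v ∈ P}

/-- The order unit norm `‖x‖_u` determined by an order unit `u`. -/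
noncomputable def ounorm (P : Set V) (u x : V) : ℝ :=
  sInf {r : ℝ | 0 ≤ r ∧ x + r • u ∈ P ∧ r • u - x ∈ P}

/-- Thompson's metric `d_T(x,y) = log inf {r ≥ 1 : r⁻¹ y ≤ x ≤ r y}`. -/
noncomputable def thompsonDist (P : Set V) (x y : V) : ℝ :=
  Real.log (sInf {r : ℝ | 1 ≤ r ∧ x - r⁻¹ • y ∈ P ∧ r • y - x ∈ P})

/-- `Φ` is a gauge-reversing bijection from the open cone of `(V, P, v)` onto the
open cone of `(W, Q, w)`: a bijection, homogeneous of degree `-1`,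
and an order-anti-isomorphism. -/
def GaugeReversing (P : Set V) (v : V) (Q : Set W) (w : W) (Φ : V → W) : Prop :=
  Set.BijOn Φ (openCone P v) (openCone Q w) ∧
  (∀ x ∈ openCone P v, ∀ r : ℝ, 0 < r → Φ (r • x) = r⁻¹ • Φ x) ∧
  (∀ x ∈ openCone P v, ∀ y ∈ openCone P v, (y - x ∈ P ↔ Φ x - Φ y ∈ Q))

/-- `Φ` is a gauge-preserving bijection from the open cone of `(V, P, v)` onto the
open cone of `(W, Q, w)`: a bijection, homogeneous of degree `1`,
and an order-isomorphism. -/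
def GaugePreserving (P : Set V) (v : V) (Q : Set W) (w : W) (Φ : V → W) : Prop :=
  Set.BijOn Φ (openCone P v) (openCone Q w) ∧
  (∀ x ∈ openCone P v, ∀ r : ℝ, 0 < r → Φ (r • x) = r • Φ x) ∧
  (∀ x ∈ openCone P v, ∀ y ∈ openCone P v, (y - x ∈ P ↔ Φ y - Φ x ∈ Q))

/-- `mul` is a JB-algebra structure on the order unit space `(V, P, v)` with unit
element `v` and cone of squares `P`. -/
def IsJBAlgebraStructure (P : Set V) (v : V) (mul : V →ₗ[ℝ] V →ₗ[ℝ] V) : Prop :=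
  (∀ x y : V, mul x y = mul y x) ∧
  (∀ x : V, mul v x = x) ∧
  (∀ x y : V, mul x (mul y (mul x x)) = mul (mul x y) (mul x x)) ∧
  (∀ x y : V, ‖mul x y‖ ≤ ‖x‖ * ‖y‖) ∧
  (∀ x : V, ‖mul x x‖ = ‖x‖ ^ 2) ∧
  (∀ x y : V, ‖mul x x‖ ≤ ‖mul x x + mul y y‖) ∧
  P = {y : V | ∃ x : V, mul x x = y}

/-- `S` is a `d_T`-symmetry of the open cone of `(V, P, v)` at the point `p`:
an involutive `d_T`-isometry of the open cone having `p` as an isolated fixed point. -/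
def IsDTSymmetry (P : Set V) (v : V) (S : V → V) (p : V) : Prop :=
  (∀ x ∈ openCone P v, S x ∈ openCone P v) ∧
  (∀ x ∈ openCone P v, S (S x) = x) ∧
  (∀ x ∈ openCone P v, ∀ y ∈ openCone P v,
    thompsonDist P (S x) (S y) = thompsonDist P x y) ∧
  p ∈ openCone P v ∧ S p = p ∧
  (∃ ε : ℝ, 0 < ε ∧ ∀ x ∈ openCone P v, S x = x → thompsonDist P p x < ε → x = p)

/-- A complete order unit space `(W, Q, w)` together with a gauge-reversing bijection
from the open cone of `(V, P, v)` onto the open cone of `(W, Q, w)`. -/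
structure GaugeReversingTarget (V : Type*) [NormedAddCommGroup V] [NormedSpace ℝ V]
    (P : Set V) (v : V) where
  W : Type
  [instGroup : NormedAddCommGroup W]
  [instSpace : NormedSpace ℝ W]
  [instComplete : CompleteSpace W]
  Q : Set W
  w : W
  ous : IsOrderUnitSpace W Q w
  Φ : V → W
  grev : GaugeReversing P v Q w Φ

/-- The state space of the order unit space `(V, P, v)`, as a subset of the
weak-* dual of `V`. -/
def stateSpace (P : Set V) (v : V) : Set (WeakDual ℝ V) :=
  {ρ | (∀ x ∈ P, 0 ≤ ρ x) ∧ ρ v = 1}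

/-- A real-valued function on the dual is affine on `K`. -/
def AffineOnK (K : Set (WeakDual ℝ V)) (g : WeakDual ℝ V → ℝ) : Prop :=
  ∀ ρ ∈ K, ∀ σ ∈ K, ∀ t : ℝ, 0 ≤ t → t ≤ 1 →
    g ((1 - t) • ρ + t • σ) = (1 - t) * g ρ + t * g σ

/-- An extended-real-valued function on the dual is affine on `K`. -/
def AffineOnKE (K : Set (WeakDual ℝ V)) (g : WeakDual ℝ V → EReal) : Prop :=
  ∀ ρ ∈ K, ∀ σ ∈ K, ∀ t : ℝ, 0 ≤ t → t ≤ 1 →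
    g ((1 - t) • ρ + t • σ) = ((1 - t : ℝ) : EReal) * g ρ + ((t : ℝ) : EReal) * g σ

/-- Membership in the extended cone `C_usc` of nonnegative affine upper semicontinuous
functions on the state space `K`. -/
def memCusc (K : Set (WeakDual ℝ V)) (g : WeakDual ℝ V → ℝ) : Prop :=
  (∀ ρ ∈ K, 0 ≤ g ρ) ∧ AffineOnK K g ∧ UpperSemicontinuousOn g K

/-- `p` is an extremal vector of the cone `C_usc` over the state space `K`. -/
def IsExtremalCusc (K : Set (WeakDual ℝ V)) (p : WeakDual ℝ V → ℝ) : Prop :=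
  memCusc K p ∧ (∃ ρ ∈ K, p ρ ≠ 0) ∧
  ∀ x, memCusc K x → (∀ ρ ∈ K, x ρ ≤ p ρ) →
    ∃ t : ℝ, 0 ≤ t ∧ t ≤ 1 ∧ ∀ ρ ∈ K, x ρ = t * p ρ

/-- The cone `C_usc` over the state space `K` is strongly atomic: each of its
members is the least upper bound of the extremal vectors it dominates. -/
def StronglyAtomicCusc (K : Set (WeakDual ℝ V)) : Prop :=
  ∀ g, memCusc K g →
    (∀ p, IsExtremalCusc K p → (∀ ρ ∈ K, p ρ ≤ g ρ) → ∀ ρ ∈ K, p ρ ≤ g ρ) ∧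
    (∀ h, memCusc K h →
      (∀ p, IsExtremalCusc K p → (∀ ρ ∈ K, p ρ ≤ g ρ) → ∀ ρ ∈ K, p ρ ≤ h ρ) →
      ∀ ρ ∈ K, g ρ ≤ h ρ)

end Defs

namespace IsOrderUnitSpace

section Basic

variable {V : Type*} [NormedAddCommGroup V] [NormedSpace ℝ V] {P : Set V} {v : V}

theorem zero_mem (hV : IsOrderUnitSpace V P v) : (0 : V) ∈ P := by
  simpa using hV.smul_mem 0 le_rfl v hV.unit_mem

theorem sub_mem_trans (hV : IsOrderUnitSpace V P v) {x y z : V} (h1 : y - x ∈ P)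
    (h2 : z - y ∈ P) : z - x ∈ P := by
  have := hV.add_mem _ h1 _ h2
  convert this using 1; module

theorem mem_of_sub_mem (hV : IsOrderUnitSpace V P v) {x y : V} (h1 : x ∈ P)
    (h2 : y - x ∈ P) : y ∈ P := by
  have := hV.add_mem _ h1 _ h2
  convert this using 1; module

theorem smul_sub_smul_mem (hV : IsOrderUnitSpace V P v) {a b : ℝ} (hab : a ≤ b) {x : V}
    (hx : x ∈ P) : b • x - a • x ∈ P := by
  have := hV.smul_mem (b - a) (by linarith) x hx
  convert this using 1; module

theorem mem_of_forall_add_smul_mem (hV : IsOrderUnitSpace V P v) {u x : V}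
    (h : ∀ δ : ℝ, 0 < δ → x + δ • u ∈ P) : x ∈ P := by
  obtain ⟨M, hM, hMu⟩ := hV.unit_order u
  have key := hV.archimedean (-x) (M • v) fun r hr => by
    rcases hr.eq_or_lt with rfl | hr
    · simpa using hV.smul_mem M hM.le v hV.unit_mem
    · have h1 := hV.smul_mem r hr.le _ (h r⁻¹ (by positivity))
      rw [smul_add, smul_inv_smul₀ hr.ne'] at h1
      have := hV.add_mem _ h1 _ hMu
      convert this using 1; module
  simpa using key

theorem openCone_subset (hV : IsOrderUnitSpace V P v) {x : V} (hx : x ∈ openCone P v) :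
    x ∈ P := by
  obtain ⟨ε, hε, h⟩ := hx
  exact hV.mem_of_sub_mem (hV.smul_mem ε hε.le v hV.unit_mem) h

theorem unit_mem_openCone (hV : IsOrderUnitSpace V P v) : v ∈ openCone P v :=
  ⟨1, one_pos, by simpa using hV.zero_mem⟩

theorem openCone_of_sub_mem (hV : IsOrderUnitSpace V P v) {x y : V} (hx : x ∈ openCone P v)
    (h : y - x ∈ P) : y ∈ openCone P v := by
  obtain ⟨ε, hε, hx⟩ := hx
  exact ⟨ε, hε, hV.sub_mem_trans hx h⟩

theorem openCone_smul_mem (hV : IsOrderUnitSpace V P v) {x : V} (hx : x ∈ openCone P v) {r : ℝ}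
    (hr : 0 < r) : r • x ∈ openCone P v := by
  obtain ⟨ε, hε, hx⟩ := hx
  refine ⟨r * ε, by positivity, ?_⟩
  have := hV.smul_mem r hr.le _ hx
  convert this using 1; module

theorem exists_smul_sub_mem (hV : IsOrderUnitSpace V P v) {u : V} (hu : u ∈ openCone P v)
    (x : V) : ∃ r : ℝ, 0 < r ∧ r • u - x ∈ P := by
  obtain ⟨ε, hε, hu⟩ := hu
  obtain ⟨r, hr, hx⟩ := hV.unit_order x
  refine ⟨r / ε, by positivity, ?_⟩
  have h := hV.smul_mem (r / ε) (by positivity) _ hu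
  have := hV.add_mem _ h _ hx
  rw [smul_sub, smul_smul, div_mul_cancel₀ _ hε.ne'] at this
  convert this using 1; module

theorem ounorm_le_iff (hV : IsOrderUnitSpace V P v) {u : V} (hu : u ∈ openCone P v) {x : V}
    {r : ℝ} (hr : 0 ≤ r) : ounorm P u x ≤ r ↔ x + r • u ∈ P ∧ r • u - x ∈ P := by
  have huP := hV.openCone_subset hu
  have hbdd : BddBelow {r : ℝ | 0 ≤ r ∧ x + r • u ∈ P ∧ r • u - x ∈ P} := ⟨0, fun _ h => h.1⟩
  constructor
  · intro h
    have hne : {r : ℝ | 0 ≤ r ∧ x + r • u ∈ P ∧ r • u - x ∈ P}.Nonempty := by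
      obtain ⟨a, ha, h1⟩ := hV.exists_smul_sub_mem hu x
      obtain ⟨b, hb, h2⟩ := hV.exists_smul_sub_mem hu (-x)
      refine ⟨a + b, by positivity, ?_, ?_⟩
      · have := hV.add_mem _ h2 _ (hV.smul_mem a ha.le u huP)
        convert this using 1; module
      · have := hV.add_mem _ h1 _ (hV.smul_mem b hb.le u huP)
        convert this using 1; module
    have key : ∀ δ : ℝ, 0 < δ → x + (r + δ) • u ∈ P ∧ (r + δ) • u - x ∈ P := by
      intro δ hδ
      obtain ⟨s, ⟨hs0, hs1, hs2⟩, hs⟩ := exists_lt_of_csInf_lt hne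
        (lt_of_le_of_lt h (lt_add_of_pos_right r hδ))
      have h3 := hV.smul_sub_smul_mem hs.le huP
      constructor
      · have := hV.add_mem _ hs1 _ h3
        convert this using 1; module
      · have := hV.add_mem _ hs2 _ h3
        convert this using 1; module
    constructor
    · refine hV.mem_of_forall_add_smul_mem (u := u) fun δ hδ => ?_
      convert (key δ hδ).1 using 1; module
    · refine hV.mem_of_forall_add_smul_mem (u := u) fun δ hδ => ?_
      convert (key δ hδ).2 using 1; module
  · exact fun h => csInf_le hbdd ⟨hr, h.1, h.2⟩

theorem ounorm_nonneg (P : Set V) (u x : V) : 0 ≤ ounorm P u x :=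
  Real.sInf_nonneg fun _ h => h.1

theorem norm_eq_ounorm (hV : IsOrderUnitSpace V P v) (x : V) : ‖x‖ = ounorm P v x :=
  hV.norm_eq x

theorem norm_le_iff (hV : IsOrderUnitSpace V P v) {x : V} {r : ℝ} (hr : 0 ≤ r) :
    ‖x‖ ≤ r ↔ x + r • v ∈ P ∧ r • v - x ∈ P := by
  rw [hV.norm_eq_ounorm, hV.ounorm_le_iff hV.unit_mem_openCone hr]

/-- The order unit norm of an arbitrary element of the open cone, as a seminorm. -/
noncomputable def seminorm (hV : IsOrderUnitSpace V P v) {u : V} (hu : u ∈ openCone P v) :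
    Seminorm ℝ V :=
  Seminorm.of (ounorm P u)
    (fun x y => by
      have hx := (hV.ounorm_le_iff hu (ounorm_nonneg P u x)).1 le_rfl
      have hy := (hV.ounorm_le_iff hu (ounorm_nonneg P u y)).1 le_rfl
      refine (hV.ounorm_le_iff hu (add_nonneg (ounorm_nonneg P u x) (ounorm_nonneg P u y))).2
        ⟨?_, ?_⟩
      · have := hV.add_mem _ hx.1 _ hy.1
        convert this using 1; module
      · have := hV.add_mem _ hx.2 _ hy.2
        convert this using 1; module)
    (by
      have key : ∀ (a : ℝ) (x : V), ounorm P u (a • x) ≤ ‖a‖ * ounorm P u x := by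
        intro a x
        have hx := (hV.ounorm_le_iff hu (ounorm_nonneg P u x)).1 le_rfl
        refine (hV.ounorm_le_iff hu (mul_nonneg (norm_nonneg _) (ounorm_nonneg P u x))).2 ?_
        have h1 := hV.smul_mem ‖a‖ (norm_nonneg _) _ hx.1
        have h2 := hV.smul_mem ‖a‖ (norm_nonneg _) _ hx.2
        rcases le_total 0 a with ha | ha
        · rw [Real.norm_of_nonneg ha] at *
          constructor
          · convert h1 using 1; module
          · convert h2 using 1; module
        · rw [Real.norm_of_nonpos ha] at *
          constructor
          · convert h2 using 1; module
          · convert h1 using 1; module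
      intro a x
      refine le_antisymm (key a x) ?_
      rcases eq_or_ne a 0 with rfl | ha
      · simpa using ounorm_nonneg P u _
      · have := key a⁻¹ (a • x)
        rw [inv_smul_smul₀ ha, norm_inv] at this
        have h := mul_le_mul_of_nonneg_left this (norm_nonneg a)
        rwa [mul_inv_cancel_left₀ (norm_ne_zero_iff.2 ha)] at h)

theorem seminorm_le_iff (hV : IsOrderUnitSpace V P v) {u : V} (hu : u ∈ openCone P v) {x : V}
    {r : ℝ} (hr : 0 ≤ r) : hV.seminorm hu x ≤ r ↔ x + r • u ∈ P ∧ r • u - x ∈ P :=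
  hV.ounorm_le_iff hu hr

theorem norm_smul_sub_mem (hV : IsOrderUnitSpace V P v) (x : V) : ‖x‖ • v - x ∈ P :=
  ((hV.norm_le_iff (norm_nonneg x)).1 le_rfl).2

theorem norm_smul_add_mem (hV : IsOrderUnitSpace V P v) (x : V) : ‖x‖ • v + x ∈ P := by
  rw [add_comm]; exact ((hV.norm_le_iff (norm_nonneg x)).1 le_rfl).1

theorem norm_le_of_mem (hV : IsOrderUnitSpace V P v) {x y : V} (hx : x ∈ P) (hxy : y - x ∈ P) :
    ‖x‖ ≤ ‖y‖ := by
  refine (hV.norm_le_iff (norm_nonneg y)).2 ⟨?_, ?_⟩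
  · exact hV.add_mem _ hx _ (hV.smul_mem _ (norm_nonneg y) _ hV.unit_mem)
  · have := hV.add_mem _ hxy _ (hV.norm_smul_sub_mem y)
    convert this using 1; module

theorem norm_le_add (hV : IsOrderUnitSpace V P v) {a x b : V} (h1 : x - a ∈ P)
    (h2 : b - x ∈ P) : ‖x‖ ≤ ‖a‖ + ‖b‖ := by
  refine (hV.norm_le_iff (by positivity)).2 ⟨?_, ?_⟩
  · have := hV.add_mem _ (hV.add_mem _ h1 _ (hV.norm_smul_add_mem a)) _
      (hV.smul_mem ‖b‖ (norm_nonneg b) _ hV.unit_mem)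
    convert this using 1; module
  · have := hV.add_mem _ (hV.add_mem _ h2 _ (hV.norm_smul_sub_mem b)) _
      (hV.smul_mem ‖a‖ (norm_nonneg a) _ hV.unit_mem)
    convert this using 1; module

theorem seminorm_le_norm (hV : IsOrderUnitSpace V P v) {u : V} {ε : ℝ} (hε : 0 < ε)
    (h : u - ε • v ∈ P) (x : V) : hV.seminorm ⟨ε, hε, h⟩ x ≤ ε⁻¹ * ‖x‖ := by
  refine (hV.seminorm_le_iff _ (by positivity)).2 ?_
  have h1 := hV.smul_mem (ε⁻¹ * ‖x‖) (by positivity) _ h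
  rw [smul_sub, smul_smul, mul_right_comm, inv_mul_cancel₀ hε.ne', one_mul] at h1
  constructor
  · have := hV.add_mem _ h1 _ (hV.norm_smul_add_mem x)
    convert this using 1; module
  · have := hV.add_mem _ h1 _ (hV.norm_smul_sub_mem x)
    convert this using 1; module

theorem norm_le_seminorm (hV : IsOrderUnitSpace V P v) {u : V} (hu : u ∈ openCone P v) (x : V) :
    ‖x‖ ≤ ‖u‖ * hV.seminorm hu x := by
  have hx := (hV.seminorm_le_iff hu (apply_nonneg _ x)).1 le_rfl
  have h1 := hV.smul_mem (hV.seminorm hu x) (apply_nonneg _ x) _ (hV.norm_smul_sub_mem u)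
  refine (hV.norm_le_iff (mul_nonneg (norm_nonneg u) (apply_nonneg _ x))).2 ⟨?_, ?_⟩
  · have := hV.add_mem _ h1 _ hx.1
    convert this using 1; module
  · have := hV.add_mem _ h1 _ hx.2
    convert this using 1; module

theorem openCone_of_norm_sub_lt (hV : IsOrderUnitSpace V P v) {x y : V} {ε : ℝ}
    (hx : x - ε • v ∈ P) (h : ‖y - x‖ < ε) : y ∈ openCone P v := by
  refine ⟨ε - ‖y - x‖, by linarith, ?_⟩
  have := hV.add_mem _ hx _ (hV.norm_smul_add_mem (y - x))
  convert this using 1; module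

theorem isOpen_openCone (hV : IsOrderUnitSpace V P v) : IsOpen (openCone P v) := by
  rw [Metric.isOpen_iff]
  rintro x ⟨ε, hε, hx⟩
  refine ⟨ε, hε, fun y hy => hV.openCone_of_norm_sub_lt hx ?_⟩
  rwa [← dist_eq_norm]

theorem isClosed_cone (hV : IsOrderUnitSpace V P v) : IsClosed P := by
  refine isClosed_of_closure_subset fun x hx => ?_
  refine hV.mem_of_forall_add_smul_mem (u := v) fun δ hδ => ?_
  obtain ⟨y, hy, hxy⟩ := Metric.mem_closure_iff.1 hx δ hδ
  rw [dist_eq_norm] at hxy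
  have := hV.add_mem _ (hV.add_mem _ hy _ (hV.norm_smul_add_mem (x - y))) _
    (hV.smul_sub_smul_mem hxy.le hV.unit_mem)
  convert this using 1; module

theorem convex_cone (hV : IsOrderUnitSpace V P v) : Convex ℝ P :=
  fun x hx y hy a b ha hb _ => hV.add_mem _ (hV.smul_mem a ha x hx) _ (hV.smul_mem b hb y hy)

theorem convex_openCone (hV : IsOrderUnitSpace V P v) : Convex ℝ (openCone P v) := by
  rintro x ⟨ε, hε, hx⟩ y ⟨δ, hδ, hy⟩ a b ha hb hab
  refine ⟨a * ε + b * δ, ?_, ?_⟩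
  · rcases ha.eq_or_lt with rfl | ha
    · have : b = 1 := by linarith
      subst this; simpa using hδ
    · positivity
  · have := hV.add_mem _ (hV.smul_mem a ha _ hx) _ (hV.smul_mem b hb _ hy)
    convert this using 1; module

end Basic

end IsOrderUnitSpace

namespace IsOrderUnitSpace

section States

variable {V : Type*} [NormedAddCommGroup V] [NormedSpace ℝ V] {P : Set V} {v : V}

theorem abs_le_norm_mul (hV : IsOrderUnitSpace V P v) (τ : WeakDual ℝ V)
    (hτ : ∀ x ∈ P, 0 ≤ τ x) (x : V) : |τ x| ≤ ‖x‖ * τ v := by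
  have h1 := hτ _ (hV.norm_smul_sub_mem x)
  have h2 := hτ _ (hV.norm_smul_add_mem x)
  rw [map_sub, map_smul, smul_eq_mul] at h1
  rw [map_add, map_smul, smul_eq_mul] at h2
  exact abs_le.2 ⟨by linarith, by linarith⟩

theorem isClosed_stateSpace (P : Set V) (v : V) : IsClosed (stateSpace P v) := by
  have : stateSpace P v = (⋂ x ∈ P, {ρ : WeakDual ℝ V | 0 ≤ ρ x}) ∩ {ρ | ρ v = 1} := by
    ext ρ; simp [stateSpace]
  rw [this]
  refine IsClosed.inter (isClosed_biInter fun x _ => ?_) ?_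
  · exact isClosed_le continuous_const (WeakDual.eval_continuous x)
  · exact isClosed_eq (WeakDual.eval_continuous v) continuous_const

theorem isCompact_stateSpace (hV : IsOrderUnitSpace V P v) : IsCompact (stateSpace P v) := by
  refine (WeakDual.isCompact_closedBall (0 : StrongDual ℝ V) 1).of_isClosed_subset
    (isClosed_stateSpace P v) fun ρ hρ => ?_
  rw [Set.mem_preimage, mem_closedBall_zero_iff]
  refine ContinuousLinearMap.opNorm_le_bound _ zero_le_one fun x => ?_
  have := hV.abs_le_norm_mul ρ hρ.1 x
  rw [hρ.2] at this
  rw [Real.norm_eq_abs, WeakDual.toStrongDual_apply]; linarith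

theorem exists_state_neg (hV : IsOrderUnitSpace V P v) {u : V} (hu : u ∉ P) :
    ∃ ρ ∈ stateSpace P v, ρ u < 0 := by
  obtain ⟨f, c, hfu, hf⟩ := geometric_hahn_banach_point_closed hV.convex_cone hV.isClosed_cone hu
  have hc : c < 0 := by simpa using hf 0 hV.zero_mem
  have hpos : ∀ x ∈ P, 0 ≤ f x := by
    intro x hx
    by_contra! hneg
    have h1 := hf _ (hV.smul_mem (c / f x) (div_nonneg_of_nonpos hc.le hneg.le) x hx)
    rw [map_smul, smul_eq_mul, div_mul_cancel₀ _ hneg.ne] at h1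
    exact lt_irrefl _ h1
  have hvpos : 0 < f v := by
    have h := hpos _ (hV.norm_smul_add_mem u)
    rw [map_add, map_smul, smul_eq_mul] at h
    have : 0 < ‖u‖ * f v := by linarith
    exact pos_of_mul_pos_right this (norm_nonneg u)
  refine ⟨(f v)⁻¹ • StrongDual.toWeakDual f, ⟨fun x hx => ?_, ?_⟩, ?_⟩
  · exact mul_nonneg (inv_nonneg.2 hvpos.le) (hpos x hx)
  · exact inv_mul_cancel₀ hvpos.ne'
  · exact mul_neg_of_pos_of_neg (inv_pos.2 hvpos) (by linarith : f u < 0)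

theorem exists_extreme_neg (hV : IsOrderUnitSpace V P v) {u : V} (hu : u ∉ P) :
    ∃ σ ∈ (stateSpace P v).extremePoints ℝ, σ u < 0 := by
  obtain ⟨ρ, hρ, hρu⟩ := hV.exists_state_neg hu
  obtain ⟨ρ₀, hρ₀, hmin⟩ := hV.isCompact_stateSpace.exists_isMinOn ⟨ρ, hρ⟩
    (WeakDual.eval_continuous u).continuousOn
  set F : Set (WeakDual ℝ V) := stateSpace P v ∩ {σ | σ u = ρ₀ u} with hF
  have hFc : IsCompact F := hV.isCompact_stateSpace.inter_right
    (isClosed_eq (WeakDual.eval_continuous u) continuous_const)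
  have : LocallyConvexSpace ℝ (WeakDual ℝ V) :=
    inferInstanceAs (LocallyConvexSpace ℝ (WeakBilin (topDualPairing ℝ V)))
  obtain ⟨σ, hσ⟩ := hFc.extremePoints_nonempty ⟨ρ₀, hρ₀, rfl⟩
  have hσF := hσ.1
  refine ⟨σ, ⟨hσF.1, fun x₁ hx₁ x₂ hx₂ hx => ?_⟩, ?_⟩
  · obtain ⟨a, b, ha, hb, hab, hs⟩ := id hx
    have h1 : ρ₀ u ≤ x₁ u := hmin hx₁
    have h2 : ρ₀ u ≤ x₂ u := hmin hx₂
    have h3 : a * x₁ u + b * x₂ u = ρ₀ u := by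
      rw [← hσF.2, ← hs]; rfl
    have key : ∀ a b m p q : ℝ, 0 < a → 0 ≤ b → a + b = 1 → m ≤ p → m ≤ q →
        a * p + b * q = m → p = m := by
      intro a b m p q ha hb hab hp hq h
      obtain rfl : b = 1 - a := by linarith
      refine le_antisymm (le_of_mul_le_mul_left ?_ ha) hp
      nlinarith [mul_nonneg hb (sub_nonneg.2 hq)]
    refine hσ.2 ⟨hx₁, ?_⟩ ⟨hx₂, ?_⟩ hx
    · exact key a b _ _ _ ha hb.le hab h1 h2 h3
    · exact key b a _ _ _ hb ha.le (by linarith) h2 h1 (by linarith)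
  · have h1 : ρ₀ u ≤ ρ u := hmin hρ
    have h2 : σ u = ρ₀ u := hσF.2
    linarith

theorem mem_of_forall_extreme (hV : IsOrderUnitSpace V P v) {u : V}
    (h : ∀ σ ∈ (stateSpace P v).extremePoints ℝ, 0 ≤ σ u) : u ∈ P := by
  by_contra hu
  obtain ⟨σ, hσ, hneg⟩ := hV.exists_extreme_neg hu
  exact (h σ hσ).not_gt hneg

theorem state_pos {σ : WeakDual ℝ V} (hσ : σ ∈ stateSpace P v)
    {x : V} (hx : x ∈ openCone P v) : 0 < σ x := by
  obtain ⟨ε, hε, hx⟩ := hx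
  have h := hσ.1 _ hx
  rw [map_sub, map_smul, hσ.2, smul_eq_mul] at h
  linarith

theorem eq_smul_of_extreme (hV : IsOrderUnitSpace V P v) {σ τ τ' : WeakDual ℝ V}
    (hσ : σ ∈ (stateSpace P v).extremePoints ℝ) (hτ : ∀ x ∈ P, 0 ≤ τ x)
    (hτ' : ∀ x ∈ P, 0 ≤ τ' x) {κ : ℝ} (h : ∀ x, τ x + τ' x = κ * σ x) (x : V) :
    τ x = τ v * σ x := by
  have ha := hτ v hV.unit_mem
  have hb := hτ' v hV.unit_mem
  have hκ : τ v + τ' v = κ := by rw [h, hσ.1.2, mul_one]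
  have hx := h x
  rcases ha.eq_or_lt with ha | ha
  · have h1 := hV.abs_le_norm_mul τ hτ x
    rw [← ha, mul_zero] at h1
    rw [← ha, zero_mul]
    exact abs_nonpos_iff.1 h1
  rcases hb.eq_or_lt with hb | hb
  · have h1 := hV.abs_le_norm_mul τ' hτ' x
    rw [← hb, mul_zero] at h1
    have h2 := abs_nonpos_iff.1 h1
    rw [h2, add_zero] at hx
    rw [hx, ← hκ, ← hb, add_zero]
  have hκ0 : 0 < κ := by linarith
  have key : (τ v)⁻¹ • τ = σ := by
    refine hσ.2 (x₁ := (τ v)⁻¹ • τ) (x₂ := (τ' v)⁻¹ • τ') ⟨fun y hy => ?_, ?_⟩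
      ⟨fun y hy => ?_, ?_⟩ ⟨τ v / κ, τ' v / κ, by positivity, by positivity, ?_, ?_⟩
    · exact mul_nonneg (inv_nonneg.2 ha.le) (hτ y hy)
    · exact inv_mul_cancel₀ ha.ne'
    · exact mul_nonneg (inv_nonneg.2 hb.le) (hτ' y hy)
    · exact inv_mul_cancel₀ hb.ne'
    · rw [← add_div, hκ, div_self hκ0.ne']
    · refine ContinuousLinearMap.ext fun y => ?_
      change τ v / κ * ((τ v)⁻¹ * τ y) + τ' v / κ * ((τ' v)⁻¹ * τ' y) = σ y
      have := h y
      field_simp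
      linarith
  have h2 : (τ v)⁻¹ * τ x = σ x := by rw [← key]; rfl
  rw [← h2, mul_inv_cancel_left₀ ha.ne']

/-- Sublevel sets of extreme states are directed upwards. -/
theorem exists_upper_bound_of_extreme (hV : IsOrderUnitSpace V P v) {σ : WeakDual ℝ V}
    (hσ : σ ∈ (stateSpace P v).extremePoints ℝ) {η : ℝ} (hη : 0 < η) {u₁ u₂ : V}
    (h₁ : σ u₁ < η) (h₂ : σ u₂ < η) : ∃ t, t - u₁ ∈ P ∧ t - u₂ ∈ P ∧ σ t < η := by
  set s : Set (V × V) := {z | ∃ t, t - z.1 ∈ openCone P v ∧ t - z.2 ∈ openCone P v ∧ σ t < η}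
    with hs
  suffices (u₁, u₂) ∈ s by
    obtain ⟨t, h1, h2, h3⟩ := this
    exact ⟨t, hV.openCone_subset h1, hV.openCone_subset h2, h3⟩
  by_contra hu
  have hopen : IsOpen s := by
    have : s = ⋃ t ∈ {t | σ t < η}, {z : V × V | t - z.1 ∈ openCone P v ∧
        t - z.2 ∈ openCone P v} := by
      ext z; simp only [hs, Set.mem_ofPred_eq, Set.mem_iUnion, exists_prop]; tauto
    rw [this]
    refine isOpen_biUnion fun t _ => ?_
    exact (hV.isOpen_openCone.preimage (continuous_const.sub continuous_fst)).inter
      (hV.isOpen_openCone.preimage (continuous_const.sub continuous_snd))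
  have hconv : Convex ℝ s := by
    rintro z ⟨t, h1, h2, h3⟩ z' ⟨t', h1', h2', h3'⟩ a b ha hb hab
    refine ⟨a • t + b • t', ?_, ?_, ?_⟩
    · convert hV.convex_openCone h1 h1' ha hb hab using 1
      simp only [Prod.fst_add, Prod.smul_fst]; module
    · convert hV.convex_openCone h2 h2' ha hb hab using 1
      simp only [Prod.snd_add, Prod.smul_snd]; module
    · rw [map_add, map_smul, map_smul, smul_eq_mul, smul_eq_mul]
      rcases ha.eq_or_lt with rfl | ha
      · have : b = 1 := by linarith
        subst this; simpa using h3'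
      · nlinarith
  obtain ⟨f, hf⟩ := geometric_hahn_banach_open_point hconv hopen hu
  set c := f (u₁, u₂) with hc
  have hσv : σ v = 1 := hσ.1.2
  have hmem : ∀ t, σ t < η → ∀ p ∈ P, ∀ q ∈ P, ∀ δ : ℝ, 0 < δ →
      (t - p - δ • v, t - q - δ • v) ∈ s := by
    intro t ht p hp q hq δ hδ
    refine ⟨t, ⟨δ, hδ, ?_⟩, ⟨δ, hδ, ?_⟩, ht⟩
    · convert hp using 1; simp only; module
    · convert hq using 1; simp only; module
  have hle : ∀ t, σ t < η → ∀ p ∈ P, ∀ q ∈ P, f (t, t) - f (p, 0) - f (0, q) ≤ c := by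
    intro t ht p hp q hq
    refine le_of_forall_pos_le_add fun ε hε => ?_
    have hδ : 0 < ε / (|f (v, v)| + 1) := by positivity
    have h := hf _ (hmem t ht p hp q hq _ hδ)
    have e : (t - p - (ε / (|f (v, v)| + 1)) • v, t - q - (ε / (|f (v, v)| + 1)) • v)
        = (t, t) - (p, 0) - (0, q) - (ε / (|f (v, v)| + 1)) • (v, v) := by
      ext <;> simp
    rw [e, map_sub, map_sub, map_sub, map_smul, smul_eq_mul] at h
    have h2 : ε / (|f (v, v)| + 1) * f (v, v) ≤ ε := by
      rw [div_mul_eq_mul_div, div_le_iff₀ (by positivity)]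
      nlinarith [le_abs_self (f (v, v)), abs_nonneg (f (v, v))]
    linarith
  have hc0 : 0 ≤ c := by
    have := hle 0 (by simpa using hη) 0 hV.zero_mem 0 hV.zero_mem
    simpa [Prod.mk_zero_zero] using this
  have hnonneg : ∀ g : V → ℝ, (∀ r : ℝ, 0 ≤ r → ∀ x, g (r • x) = r * g x) →
      (∀ p ∈ P, - g p ≤ c) → ∀ p ∈ P, 0 ≤ g p := by
    intro g hg hgc p hp
    by_contra! hneg
    have h1 := hgc _ (hV.smul_mem ((c + 1) / - g p) (div_nonneg (by linarith) (by linarith)) p hp)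
    rw [hg _ (div_nonneg (by linarith) (by linarith)), div_mul_eq_mul_div, ← div_neg, neg_neg,
      mul_div_cancel_right₀ _ hneg.ne] at h1
    linarith
  have hf1 : ∀ p ∈ P, 0 ≤ f (p, 0) := by
    refine hnonneg (fun p => f (p, 0)) (fun r _ x => ?_) fun p hp => ?_
    · have : (r • x, (0 : V)) = r • (x, (0 : V)) := by simp
      simp only [this, map_smul, smul_eq_mul]
    · have := hle 0 (by simpa using hη) p hp 0 hV.zero_mem
      simpa using this
  have hf2 : ∀ p ∈ P, 0 ≤ f (0, p) := by
    refine hnonneg (fun p => f (0, p)) (fun r _ x => ?_) fun p hp => ?_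
    · have : ((0 : V), r • x) = r • ((0 : V), x) := by simp
      simp only [this, map_smul, smul_eq_mul]
    · have := hle 0 (by simpa using hη) 0 hV.zero_mem p hp
      simpa using this
  set κ := f (v, v) with hκ
  have hsplit : ∀ x y, f (x, y) = f (x, 0) + f (0, y) := by
    intro x y; rw [← map_add]; simp
  have hlt : ∀ t, σ t < η → f (t, t) ≤ c := by
    intro t ht
    have := hle t ht 0 hV.zero_mem 0 hV.zero_mem
    simpa [Prod.mk_zero_zero] using this
  have hker : ∀ t, σ t = 0 → f (t, t) ≤ 0 := by
    intro t ht
    by_contra! hpos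
    have h1 := hlt (((c + 1) / f (t, t)) • t) (by rw [map_smul, ht]; simpa using hη)
    have e : (((c + 1) / f (t, t)) • t, ((c + 1) / f (t, t)) • t)
      = ((c + 1) / f (t, t)) • (t, t) := by simp
    rw [e, map_smul, smul_eq_mul, div_mul_cancel₀ _ hpos.ne'] at h1
    linarith
  have hdiag : ∀ t, f (t, t) = κ * σ t := by
    intro t
    have h1 := hker (t - σ t • v) (by simp [hσv])
    have h2 := hker (-(t - σ t • v)) (by simp [hσv])
    have e1 : (t - σ t • v, t - σ t • v) = (t, t) - σ t • (v, v) := by simp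
    have e2 : (-(t - σ t • v), -(t - σ t • v)) = -((t, t) - σ t • (v, v)) := by simp
    rw [e1, map_sub, map_smul, smul_eq_mul] at h1
    rw [e2, map_neg, map_sub, map_smul, smul_eq_mul] at h2
    linarith [mul_comm (σ t) κ]
  have hκη : κ * η ≤ c := by
    refine le_of_forall_pos_le_add fun ε hε => ?_
    have hd : 0 < ε / (|κ| + 1) := by positivity
    have h := hlt ((η - ε / (|κ| + 1)) • v) (by simp [hσv, hd])
    rw [hdiag, map_smul, hσv, smul_eq_mul, mul_one] at h
    have h2 : ε / (|κ| + 1) * κ ≤ ε := by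
      rw [div_mul_eq_mul_div, div_le_iff₀ (by positivity)]
      nlinarith [le_abs_self κ, abs_nonneg κ]
    nlinarith
  let τ₁ : WeakDual ℝ V := StrongDual.toWeakDual (f.comp (ContinuousLinearMap.inl ℝ V V))
  let τ₂ : WeakDual ℝ V := StrongDual.toWeakDual (f.comp (ContinuousLinearMap.inr ℝ V V))
  have e1 : ∀ x, τ₁ x = f (x, 0) := fun x => rfl
  have e2 : ∀ x, τ₂ x = f (0, x) := fun x => rfl
  have k1 := hV.eq_smul_of_extreme hσ (τ := τ₁) (τ' := τ₂) hf1 hf2 (κ := κ)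
    (fun x => by rw [e1, e2, ← hsplit, hdiag]) u₁
  have k2 := hV.eq_smul_of_extreme hσ (τ := τ₂) (τ' := τ₁) hf2 hf1 (κ := κ)
    (fun x => by rw [e1, e2, add_comm, ← hsplit, hdiag]) u₂
  have hl1 := hf1 v hV.unit_mem
  have hl2 := hf2 v hV.unit_mem
  have hκ' : κ = f (v, 0) + f (0, v) := hsplit v v
  have hcc : c = f (v, 0) * σ u₁ + f (0, v) * σ u₂ := by
    rw [hc, hsplit, ← e1, ← e2, k1, k2, e1, e2]
  have hzero : f (v, 0) = 0 ∧ f (0, v) = 0 := by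
    constructor <;> nlinarith
  have hvs := hf _ (hmem 0 (by simpa using hη) 0 hV.zero_mem 0 hV.zero_mem 1 one_pos)
  have e3 : ((0 : V) - 0 - (1 : ℝ) • v, (0 : V) - 0 - (1 : ℝ) • v) = -(v, v) := by simp
  rw [e3, map_neg, ← hκ, hκ', hcc, hzero.1, hzero.2] at hvs
  simp at hvs

end States

end IsOrderUnitSpace

section Gauge

variable {V : Type*} [NormedAddCommGroup V] [NormedSpace ℝ V] {P : Set V} {v : V}
variable {W : Type*} [NormedAddCommGroup W] [NormedSpace ℝ W] {Q : Set W} {w : W}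

theorem GaugeReversing.mapsTo {Φ : V → W} (hΦ : GaugeReversing P v Q w Φ) {x : V}
    (hx : x ∈ openCone P v) : Φ x ∈ openCone Q w :=
  hΦ.1.1 hx

theorem GaugeReversing.exists_inverse {Φ : V → W} (hV : IsOrderUnitSpace V P v)
    (hΦ : GaugeReversing P v Q w Φ) :
    ∃ Ψ : W → V, GaugeReversing Q w P v Ψ ∧ (∀ x ∈ openCone P v, Ψ (Φ x) = x) ∧
      (∀ y ∈ openCone Q w, Φ (Ψ y) = y) := by
  have hinv := hΦ.1.invOn_invFunOn
  set Ψ := Function.invFunOn Φ (openCone P v)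
  have hbij : Set.BijOn Ψ (openCone Q w) (openCone P v) := hΦ.1.symm hinv.symm
  refine ⟨Ψ, ⟨hbij, fun y hy r hr => ?_, fun y hy z hz => ?_⟩, fun x hx => hinv.1 hx,
    fun y hy => hinv.2 hy⟩
  · have hx := hbij.1 hy
    have h := hΦ.2.1 _ hx r⁻¹ (inv_pos.2 hr)
    rw [hinv.2 hy, inv_inv] at h
    rw [← h, hinv.1 (hV.openCone_smul_mem hx (inv_pos.2 hr))]
  · rw [hΦ.2.2 _ (hbij.1 hz) _ (hbij.1 hy), hinv.2 hy, hinv.2 hz]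

theorem GaugePreserving.exists_inverse {Φ : V → W} (hV : IsOrderUnitSpace V P v)
    (hΦ : GaugePreserving P v Q w Φ) :
    ∃ Ψ : W → V, GaugePreserving Q w P v Ψ ∧ (∀ x ∈ openCone P v, Ψ (Φ x) = x) ∧
      (∀ y ∈ openCone Q w, Φ (Ψ y) = y) := by
  have hinv := hΦ.1.invOn_invFunOn
  set Ψ := Function.invFunOn Φ (openCone P v)
  have hbij : Set.BijOn Ψ (openCone Q w) (openCone P v) := hΦ.1.symm hinv.symm
  refine ⟨Ψ, ⟨hbij, fun y hy r hr => ?_, fun y hy z hz => ?_⟩, fun x hx => hinv.1 hx,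
    fun y hy => hinv.2 hy⟩
  · have hx := hbij.1 hy
    have h := hΦ.2.1 _ hx r hr
    rw [hinv.2 hy] at h
    rw [← h, hinv.1 (hV.openCone_smul_mem hx hr)]
  · rw [hΦ.2.2 _ (hbij.1 hy) _ (hbij.1 hz), hinv.2 hy, hinv.2 hz]

theorem GaugeReversing.comp {U : Type*} [NormedAddCommGroup U] [NormedSpace ℝ U] {R : Set U}
    {u : U} {Φ : V → W} {Ψ : W → U} (hΦ : GaugeReversing P v Q w Φ)
    (hΨ : GaugeReversing Q w R u Ψ) : GaugePreserving P v R u (Ψ ∘ Φ) := by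
  refine ⟨hΨ.1.comp hΦ.1, fun x hx r hr => ?_, fun x hx y hy => ?_⟩
  · simp only [Function.comp_apply]
    rw [hΦ.2.1 x hx r hr, hΨ.2.1 _ (hΦ.1.1 hx) _ (inv_pos.2 hr), inv_inv]
  · rw [hΦ.2.2 x hx y hy, hΨ.2.2 _ (hΦ.1.1 hy) _ (hΦ.1.1 hx)]; rfl

theorem GaugeReversing.convex (hV : IsOrderUnitSpace V P v) (hW : IsOrderUnitSpace W Q w)
    {Φ : V → W} (hΦ : GaugeReversing P v Q w Φ) {x y : V} (hx : x ∈ openCone P v)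
    (hy : y ∈ openCone P v) {a b : ℝ} (ha : 0 ≤ a) (hb : 0 ≤ b) (hab : a + b = 1) :
    a • Φ x + b • Φ y - Φ (a • x + b • y) ∈ Q := by
  obtain ⟨Ψ, hΨ, hl, hr⟩ := hΦ.exists_inverse hV
  refine hW.mem_of_forall_extreme fun σ hσ => ?_
  have quasi : ∀ x ∈ openCone P v, ∀ y ∈ openCone P v, ∀ η : ℝ, 0 < η → σ (Φ x) < η →
      σ (Φ y) < η → ∀ a b : ℝ, 0 ≤ a → 0 ≤ b → a + b = 1 → σ (Φ (a • x + b • y)) < η := by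
    intro x hx y hy η hη h1 h2 a b ha hb hab
    obtain ⟨t, ht1, ht2, ht⟩ := hW.exists_upper_bound_of_extreme hσ hη h1 h2
    have htD := hW.openCone_of_sub_mem (hΦ.mapsTo hx) ht1
    have hz := hV.convex_openCone hx hy ha hb hab
    have k1 := (hΨ.2.2 _ (hΦ.mapsTo hx) _ htD).1 ht1
    have k2 := (hΨ.2.2 _ (hΦ.mapsTo hy) _ htD).1 ht2
    rw [hl x hx] at k1
    rw [hl y hy] at k2
    have k3 : (a • x + b • y) - Ψ t ∈ P := by
      have := hV.add_mem _ (hV.smul_mem a ha _ k1) _ (hV.smul_mem b hb _ k2)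
      obtain rfl : b = 1 - a := by linarith
      convert this using 1; module
    have k4 := (hΦ.2.2 _ (hΨ.mapsTo htD) _ hz).1 k3
    rw [hr t htD] at k4
    have := hσ.1.1 _ k4
    rw [map_sub] at this
    linarith
  have hz := hV.convex_openCone hx hy ha hb hab
  have hA := IsOrderUnitSpace.state_pos hσ.1 (hΦ.mapsTo hx)
  have hB := IsOrderUnitSpace.state_pos hσ.1 (hΦ.mapsTo hy)
  set A := σ (Φ x) with hAdef
  set B := σ (Φ y) with hBdef
  have hsum : 0 < a * B + b * A := by
    rcases ha.eq_or_lt with rfl | ha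
    · have : b = 1 := by linarith
      subst this; simpa using hA
    · positivity
  have hc : 0 < a / A + b / B := by
    rw [div_add_div _ _ hA.ne' hB.ne']
    refine div_pos (by linarith [mul_comm A b]) (by positivity)
  set c := a / A + b / B with hcdef
  have hcomb : a • x + b • y = c • ((a / A / c) • (A • x) + (b / B / c) • (B • y)) := by
    rw [smul_add, smul_smul, smul_smul, smul_smul, smul_smul, mul_div_cancel₀ _ hc.ne',
      mul_div_cancel₀ _ hc.ne', div_mul_cancel₀ _ hA.ne', div_mul_cancel₀ _ hB.ne']
  have hsum1 : a / A / c + b / B / c = 1 := by rw [← add_div, ← hcdef, div_self hc.ne']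
  have hle : σ (Φ ((a / A / c) • (A • x) + (b / B / c) • (B • y))) ≤ 1 := by
    refine le_of_forall_pos_lt_add fun ε hε => ?_
    refine quasi _ (hV.openCone_smul_mem hx hA) _ (hV.openCone_smul_mem hy hB) _ (by linarith)
      ?_ ?_ _ _ (by positivity) (by positivity) hsum1
    · rw [hΦ.2.1 x hx A hA, map_smul, ← hAdef, smul_eq_mul, inv_mul_cancel₀ hA.ne']; linarith
    · rw [hΦ.2.1 y hy B hB, map_smul, ← hBdef, smul_eq_mul, inv_mul_cancel₀ hB.ne']; linarith
  have hz' := hV.convex_openCone (hV.openCone_smul_mem hx hA) (hV.openCone_smul_mem hy hB)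
    (a := a / A / c) (b := b / B / c) (by positivity) (by positivity) hsum1
  rw [map_sub, map_add, map_smul, map_smul, hcomb, hΦ.2.1 _ hz' c hc, map_smul, smul_eq_mul,
    smul_eq_mul, smul_eq_mul, ← hAdef, ← hBdef, sub_nonneg]
  have h1 : c⁻¹ * σ (Φ ((a / A / c) • (A • x) + (b / B / c) • (B • y))) ≤ c⁻¹ :=
    mul_le_of_le_one_right (by positivity) hle
  refine h1.trans ?_
  rw [inv_le_iff_one_le_mul₀ hc, hcdef, div_add_div _ _ hA.ne' hB.ne', ← mul_div_assoc,
    le_div_iff₀ (by positivity)]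
  obtain rfl : b = 1 - a := by linarith
  nlinarith [mul_nonneg (mul_nonneg ha hb) (sq_nonneg (A - B))]

theorem GaugePreserving.subadditive (hV : IsOrderUnitSpace V P v) (hW : IsOrderUnitSpace W Q w)
    {Φ : V → W} (hΦ : GaugePreserving P v Q w Φ) {x y : V} (hx : x ∈ openCone P v)
    (hy : y ∈ openCone P v) : Φ x + Φ y - Φ (x + y) ∈ Q := by
  obtain ⟨Ψ, hΨ, hl, hr⟩ := hΦ.exists_inverse hV
  refine hW.mem_of_forall_extreme fun σ hσ => ?_
  have quasi : ∀ x ∈ openCone P v, ∀ y ∈ openCone P v, ∀ η : ℝ, 0 < η → σ (Φ x) < η →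
      σ (Φ y) < η → ∀ a b : ℝ, 0 ≤ a → 0 ≤ b → a + b = 1 → σ (Φ (a • x + b • y)) < η := by
    intro x hx y hy η hη h1 h2 a b ha hb hab
    obtain ⟨t, ht1, ht2, ht⟩ := hW.exists_upper_bound_of_extreme hσ hη h1 h2
    have htD := hW.openCone_of_sub_mem (hΦ.1.1 hx) ht1
    have hz := hV.convex_openCone hx hy ha hb hab
    have k1 := (hΨ.2.2 _ (hΦ.1.1 hx) _ htD).1 ht1
    have k2 := (hΨ.2.2 _ (hΦ.1.1 hy) _ htD).1 ht2
    rw [hl x hx] at k1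
    rw [hl y hy] at k2
    have k3 : Ψ t - (a • x + b • y) ∈ P := by
      have := hV.add_mem _ (hV.smul_mem a ha _ k1) _ (hV.smul_mem b hb _ k2)
      obtain rfl : b = 1 - a := by linarith
      convert this using 1; module
    have k4 := (hΦ.2.2 _ hz _ (hΨ.1.1 htD)).1 k3
    rw [hr t htD] at k4
    have := hσ.1.1 _ k4
    rw [map_sub] at this
    linarith
  have hA := IsOrderUnitSpace.state_pos hσ.1 (hΦ.1.1 hx)
  have hB := IsOrderUnitSpace.state_pos hσ.1 (hΦ.1.1 hy)
  set A := σ (Φ x) with hAdef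
  set B := σ (Φ y) with hBdef
  have hc : 0 < A + B := by linarith
  have hcomb : x + y = (A + B) • ((A / (A + B)) • (A⁻¹ • x) + (B / (A + B)) • (B⁻¹ • y)) := by
    rw [smul_add, smul_smul, smul_smul, smul_smul, smul_smul, mul_div_cancel₀ _ hc.ne',
      mul_div_cancel₀ _ hc.ne', mul_inv_cancel₀ hA.ne', mul_inv_cancel₀ hB.ne', one_smul, one_smul]
  have hsum1 : A / (A + B) + B / (A + B) = 1 := by rw [← add_div, div_self hc.ne']
  have hx' := hV.openCone_smul_mem hx (inv_pos.2 hA)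
  have hy' := hV.openCone_smul_mem hy (inv_pos.2 hB)
  have hle : σ (Φ ((A / (A + B)) • (A⁻¹ • x) + (B / (A + B)) • (B⁻¹ • y))) ≤ 1 := by
    refine le_of_forall_pos_lt_add fun ε hε => ?_
    refine quasi _ hx' _ hy' _ (by linarith) ?_ ?_ _ _ (by positivity) (by positivity) hsum1
    · rw [hΦ.2.1 x hx _ (inv_pos.2 hA), map_smul, ← hAdef, smul_eq_mul, inv_mul_cancel₀ hA.ne']
      linarith
    · rw [hΦ.2.1 y hy _ (inv_pos.2 hB), map_smul, ← hBdef, smul_eq_mul, inv_mul_cancel₀ hB.ne']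
      linarith
  have hz' := hV.convex_openCone hx' hy' (a := A / (A + B)) (b := B / (A + B)) (by positivity)
    (by positivity) hsum1
  rw [map_sub, map_add, hcomb, hΦ.2.1 _ hz' _ hc, map_smul, smul_eq_mul, ← hAdef, ← hBdef,
    sub_nonneg]
  exact mul_le_of_le_one_right hc.le hle

theorem IsOrderUnitSpace.sub_smul_mem_of_seminorm_le (hV : IsOrderUnitSpace V P v) {x h : V}
    (hx : x ∈ openCone P v) {s : ℝ} (hs : 0 ≤ s) (h1 : hV.seminorm hx h ≤ s) :
    x + h - (1 - s) • x ∈ P := by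
  have := ((hV.seminorm_le_iff hx hs).1 h1).1
  convert this using 1; module

theorem IsOrderUnitSpace.add_mem_openCone_of_seminorm_le (hV : IsOrderUnitSpace V P v) {x h : V}
    (hx : x ∈ openCone P v) {s : ℝ} (hs : 0 ≤ s) (hs1 : s < 1) (h1 : hV.seminorm hx h ≤ s) :
    x + h ∈ openCone P v :=
  hV.openCone_of_sub_mem (hV.openCone_smul_mem hx (by linarith : 0 < 1 - s))
    (hV.sub_smul_mem_of_seminorm_le hx hs h1)

theorem GaugeReversing.one_sided_bound (hV : IsOrderUnitSpace V P v)
    (hW : IsOrderUnitSpace W Q w) {Φ : V → W} (hΦ : GaugeReversing P v Q w Φ) {x p q : V}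
    (hx : x ∈ openCone P v) {c r : ℝ} (hc : 0 < c) (hr : 0 ≤ r) (hp : p - c • x ∈ P)
    (hq : q - c • x ∈ P) (hpq : q + r • x - p ∈ P) :
    (r / c ^ 2) • Φ x - (Φ q - Φ p) ∈ Q := by
  have hcx := hV.openCone_smul_mem hx hc
  have hpC := hV.openCone_of_sub_mem hcx hp
  have hqC := hV.openCone_of_sub_mem hcx hq
  have hρ : 0 < 1 + r / c := by positivity
  have h1 : (1 + r / c) • q - p ∈ P := by
    have := hV.add_mem _ hpq _ (hV.smul_mem (r / c) (by positivity) _ hq)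
    rw [smul_sub, smul_smul, div_mul_cancel₀ _ hc.ne'] at this
    convert this using 1; module
  have h2 := (hΦ.2.2 _ hpC _ (hV.openCone_smul_mem hqC hρ)).1 h1
  rw [hΦ.2.1 _ hqC _ hρ] at h2
  have h3 := (hΦ.2.2 _ hcx _ hqC).1 hq
  rw [hΦ.2.1 _ hx _ hc] at h3
  have h4 : 0 ≤ r / c - (1 - (1 + r / c)⁻¹) := by
    have : (1 + r / c) * (1 + r / c)⁻¹ = 1 := mul_inv_cancel₀ hρ.ne'
    have h5 : (1 + r / c)⁻¹ ≤ 1 := inv_le_one_of_one_le₀ (by linarith [div_nonneg hr hc.le])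
    have h6 : 0 ≤ r / c := by positivity
    nlinarith [inv_pos.2 hρ]
  have h5 := hW.smul_mem (r / c) (by positivity) _ h3
  have h6 := hW.smul_mem _ h4 _ (hW.openCone_subset (hΦ.mapsTo hqC))
  have := hW.add_mem _ (hW.add_mem _ h2 _ h5) _ h6
  convert this using 1
  rw [show r / c ^ 2 = r / c * c⁻¹ by field_simp]
  module

theorem GaugeReversing.seminorm_sub_le (hV : IsOrderUnitSpace V P v)
    (hW : IsOrderUnitSpace W Q w) {Φ : V → W} (hΦ : GaugeReversing P v Q w Φ) {x h k : V}
    (hx : x ∈ openCone P v) {s : ℝ} (hs : 0 ≤ s) (hs1 : s < 1) (hh : hV.seminorm hx h ≤ s)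
    (hk : hV.seminorm hx k ≤ s) :
    hW.seminorm (hΦ.mapsTo hx) (Φ (x + h) - Φ (x + k)) ≤ hV.seminorm hx (h - k) / (1 - s) ^ 2 := by
  have hr : 0 ≤ hV.seminorm hx (h - k) := apply_nonneg _ _
  have hb := (hV.seminorm_le_iff hx hr).1 le_rfl
  have hc : 0 < 1 - s := by linarith
  have h1 := hV.sub_smul_mem_of_seminorm_le hx hs hh
  have h2 := hV.sub_smul_mem_of_seminorm_le hx hs hk
  refine (hW.seminorm_le_iff _ (by positivity)).2 ⟨?_, ?_⟩
  · have := hΦ.one_sided_bound hV hW hx hc hr h1 h2 (by convert hb.2 using 1; module)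
    convert this using 1; module
  · exact hΦ.one_sided_bound hV hW hx hc hr h2 h1 (by convert hb.1 using 1; module)

end Gauge

section MazurUlam

theorem Seminorm.approx_isometry_map_zero_le {E : Type*} [AddCommGroup E] [Module ℝ E]
    (N : Seminorm ℝ E) {h : E} (hh : N h ≤ 1) (n : ℕ) :
    ∀ (g g' : E → E) (ε : ℝ), 0 ≤ ε → ε ≤ (1 / 2) ^ n →
      (∀ p q, N p ≤ 4 * n + 4 → N q ≤ 4 * n + 4 → N (g p - g q) ≤ N (p - q) + ε) →
      (∀ p q, N p ≤ 4 * n + 4 → N q ≤ 4 * n + 4 → N (g' p - g' q) ≤ N (p - q) + ε) →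
      (∀ p, N p ≤ 4 * n + 4 → g' (g p) = p) → (∀ p, N p ≤ 4 * n + 4 → g (g' p) = p) →
      g h = h → g (-h) = -h → N (g 0) ≤ 2 * (1 / 2) ^ n + (n + 1) * ε := by
  have bound : ∀ (R : ℝ) (g : E → E) (ε : ℝ), 1 ≤ R → ε ≤ 1 →
      (∀ p q, N p ≤ R → N q ≤ R → N (g p - g q) ≤ N (p - q) + ε) → g h = h →
      ∀ p, N p ≤ R → N (g p) ≤ N p + 2 + ε := by
    intro R g ε hR hε hg hgh p hp
    have h1 := hg p h hp (hh.trans hR)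
    rw [hgh] at h1
    have h2 : N (g p) ≤ N (g p - h) + N h := by simpa using map_add_le_add N (g p - h) h
    have h3 := map_sub_le_add N p h
    linarith
  induction n with
  | zero =>
    intro g g' ε hε hε1 hg _ _ _ hgh _
    have h1 := hg 0 h (by simp) (by norm_num; linarith)
    rw [hgh] at h1
    have h2 : N (g 0) ≤ N (g 0 - h) + N h := by simpa using map_add_le_add N (g 0 - h) h
    have h3 : N (0 - h) = N h := by rw [zero_sub, map_neg_eq_map]
    norm_num
    linarith
  | succ n ih =>
    intro g g' ε hε hε1 hg hg' hl hr hgh hgh'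
    push_cast at hg hg' hl hr
    have hn : (0 : ℝ) ≤ n := n.cast_nonneg
    have hpow : ((1 : ℝ) / 2) ^ (n + 1) = (1 / 2) ^ n / 2 := by ring
    have hpow1 : ((1 : ℝ) / 2) ^ n ≤ 1 := pow_le_one₀ (by norm_num) (by norm_num)
    have hε2 : ε ≤ 1 := by linarith
    have hg'h : g' h = h := by
      have := hl h (by linarith); rwa [hgh] at this
    have hg'h' : g' (-h) = -h := by
      have := hl (-h) (by rw [map_neg_eq_map]; linarith); rwa [hgh'] at this
    have hb : ∀ p, N p ≤ 4 * n + 4 → N (-g p) ≤ 4 * (n + 1) + 4 := by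
      intro p hp
      have := bound _ g ε (by linarith) hε2 hg hgh p (by linarith)
      rw [map_neg_eq_map]; linarith
    have hneg : ∀ p, N p ≤ 4 * n + 4 → N (-p) ≤ 4 * n + 4 := by
      intro p hp; rwa [map_neg_eq_map]
    have hnn : ∀ a b : E, N (-a - -b) = N (a - b) := by
      intro a b; rw [← map_neg_eq_map N (a - b)]; congr 1; abel
    have key := ih (fun p => -g' (-g p)) (fun p => g' (-g (-p))) (2 * ε) (by linarith)
      (by linarith)
      (fun p q hp hq => by
        have h1 := hg' _ _ (hb p hp) (hb q hq)
        have h2 := hg p q (by linarith) (by linarith)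
        rw [hnn] at h1 ⊢
        linarith)
      (fun p q hp hq => by
        have h1 := hg' _ _ (hb _ (hneg p hp)) (hb _ (hneg q hq))
        have h2 := hg (-p) (-q) (by linarith [hneg p hp]) (by linarith [hneg q hq])
        rw [hnn] at h1 h2
        linarith)
      (fun p hp => by
        simp only [neg_neg]
        rw [hr _ (hb p hp), neg_neg, hl p (by linarith)])
      (fun p hp => by
        rw [hr _ (hb _ (hneg p hp)), neg_neg, hl _ (by linarith [hneg p hp]), neg_neg])
      (by simp only [hgh, hg'h', neg_neg])
      (by simp only [hgh', neg_neg, hg'h])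
    simp only [map_neg_eq_map] at key
    have h0 : N 0 ≤ 4 * (n : ℝ) + 4 := by rw [map_zero]; linarith
    have hg0 := hb 0 h0
    have hpos : 0 ≤ ((1 : ℝ) / 2) ^ n := by positivity
    have h1 := hg (g' (-g 0)) 0 (by nlinarith) (by linarith)
    rw [hr _ hg0, sub_zero] at h1
    have h2 : N (-g 0 - g 0) = 2 * N (g 0) := by
      have : -g 0 - g 0 = (-2 : ℝ) • g 0 := by module
      rw [this, map_smul_eq_mul]; norm_num
    push_cast
    nlinarith

theorem Seminorm.approx_isometry_midpoint {E F : Type*} [AddCommGroup E] [Module ℝ E]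
    [AddCommGroup F] [Module ℝ F] (N : Seminorm ℝ E) (M : Seminorm ℝ F) (n : ℕ)
    (f : E → F) (f' : F → E) {ε : ℝ} (hε : 0 ≤ ε) (hε1 : 2 * ε ≤ (1 / 2) ^ n)
    (hf : ∀ p q, N p ≤ 4 * n + 9 → N q ≤ 4 * n + 9 → M (f p - f q) ≤ N (p - q) + ε)
    (hf' : ∀ p q, M p ≤ 4 * n + 9 → M q ≤ 4 * n + 9 → N (f' p - f' q) ≤ M (p - q) + ε)
    (hl : ∀ p, N p ≤ 4 * n + 9 → f' (f p) = p) (hr : ∀ p, M p ≤ 4 * n + 9 → f (f' p) = p)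
    (hf0 : f 0 = 0) {h : E} (hh : N h ≤ 1) :
    M (f h + f (-h)) ≤ 2 * (1 / 2) ^ n + (2 * n + 3) * ε := by
  have hn : (0 : ℝ) ≤ n := n.cast_nonneg
  have hpow1 : ((1 : ℝ) / 2) ^ n ≤ 1 := pow_le_one₀ (by norm_num) (by norm_num)
  have hpos : 0 ≤ ((1 : ℝ) / 2) ^ n := by positivity
  have hN0 : N 0 ≤ 4 * (n : ℝ) + 9 := by rw [map_zero]; linarith
  have hfb : ∀ p, N p ≤ 4 * n + 9 → M (f p) ≤ N p + ε := by
    intro p hp; simpa [hf0] using hf p 0 hp hN0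
  have hh' : N (-h) ≤ 1 := by rwa [map_neg_eq_map]
  set k := f h + f (-h) with hk
  have hMk : M k ≤ 2 + 2 * ε := by
    have h1 := map_add_le_add M (f h) (f (-h))
    have h2 := hfb h (by linarith)
    have h3 := hfb (-h) (by linarith)
    linarith
  have hb : ∀ p, N p ≤ 4 * n + 4 → M (k - f p) ≤ 4 * n + 9 := by
    intro p hp
    have h1 := map_sub_le_add M k (f p)
    have h2 := hfb p (by linarith)
    linarith
  have hneg : ∀ p, N p ≤ 4 * n + 4 → N (-p) ≤ 4 * n + 4 := by
    intro p hp; rwa [map_neg_eq_map]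
  have hnn : ∀ a b : E, N (-a - -b) = N (a - b) := by
    intro a b; rw [← map_neg_eq_map N (a - b)]; congr 1; abel
  have hkk : ∀ a b : F, M (k - a - (k - b)) = M (a - b) := by
    intro a b; rw [← map_neg_eq_map M (a - b)]; congr 1; abel
  have key := Seminorm.approx_isometry_map_zero_le N hh n (fun p => f' (k - f (-p)))
    (fun p => -f' (k - f p)) (2 * ε) (by linarith) hε1
    (fun p q hp hq => by
      have h1 := hf' _ _ (hb _ (hneg p hp)) (hb _ (hneg q hq))
      have h2 := hf (-p) (-q) (by linarith [hneg p hp]) (by linarith [hneg q hq])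
      rw [hkk] at h1
      rw [hnn] at h2
      linarith)
    (fun p q hp hq => by
      have h1 := hf' _ _ (hb p hp) (hb q hq)
      have h2 := hf p q (by linarith) (by linarith)
      rw [hkk] at h1
      rw [hnn]
      linarith)
    (fun p hp => by
      rw [hr _ (hb _ (hneg p hp)), sub_sub_cancel, hl _ (by linarith [hneg p hp]), neg_neg])
    (fun p hp => by
      simp only [neg_neg]
      rw [hr _ (hb p hp), sub_sub_cancel, hl p (by linarith)])
    (by simp only [hk, add_sub_cancel_right]; exact hl h (by linarith))
    (by simp only [hk, neg_neg, add_sub_cancel_left]; exact hl _ (by linarith))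
  simp only [neg_zero, hf0, sub_zero] at key
  have h1 := hfb (f' k) (by nlinarith)
  rw [hr k (by linarith)] at h1
  linarith

variable {V : Type*} [NormedAddCommGroup V] [NormedSpace ℝ V] {P : Set V} {v : V}
variable {W : Type*} [NormedAddCommGroup W] [NormedSpace ℝ W] {Q : Set W} {w : W}

theorem GaugeReversing.rescaled_near_isometry (hV : IsOrderUnitSpace V P v)
    (hW : IsOrderUnitSpace W Q w) {Φ : V → W} (hΦ : GaugeReversing P v Q w Φ) {x : V}
    (hx : x ∈ openCone P v) {s R : ℝ} (hs : 0 < s) (hR : 0 ≤ R) (hsR : s * R < 1) {p q : V}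
    (hp : hV.seminorm hx p ≤ R) (hq : hV.seminorm hx q ≤ R) :
    hW.seminorm (hΦ.mapsTo hx) (s⁻¹ • (Φ (x + s • p) - Φ x) - s⁻¹ • (Φ (x + s • q) - Φ x)) ≤
      hV.seminorm hx (p - q) + 2 * R * (((1 - s * R) ^ 2)⁻¹ - 1) := by
  have hsm : ∀ z, hV.seminorm hx (s • z) = s * hV.seminorm hx z := by
    intro z; rw [map_smul_eq_mul, Real.norm_of_nonneg hs.le]
  have h1 := hΦ.seminorm_sub_le hV hW hx (h := s • p) (k := s • q) (mul_nonneg hs.le hR) hsR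
    (by rw [hsm]; gcongr) (by rw [hsm]; gcongr)
  rw [← smul_sub, hsm] at h1
  rw [← smul_sub, sub_sub_sub_cancel_right, map_smul_eq_mul, norm_inv, Real.norm_of_nonneg hs.le]
  have h2 := map_sub_le_add (hV.seminorm hx) p q
  have h3 : s⁻¹ * (s * hV.seminorm hx (p - q) / (1 - s * R) ^ 2)
      = hV.seminorm hx (p - q) + hV.seminorm hx (p - q) * (((1 - s * R) ^ 2)⁻¹ - 1) := by
    have : 1 - s * R ≠ 0 := by linarith
    field_simp
    ring
  have h4 : 0 ≤ ((1 - s * R) ^ 2)⁻¹ - 1 := by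
    have h5 : 0 < 1 - s * R := by linarith
    have : 1 ≤ ((1 - s * R) ^ 2)⁻¹ := by
      rw [one_le_inv₀ (by positivity)]
      have : 0 ≤ s * R := by positivity
      nlinarith
    linarith
  calc _ ≤ s⁻¹ * (s * hV.seminorm hx (p - q) / (1 - s * R) ^ 2) := by gcongr
    _ = _ := h3
    _ ≤ _ := by gcongr; linarith

theorem GaugeReversing.second_difference_isLittleO (hV : IsOrderUnitSpace V P v)
    (hW : IsOrderUnitSpace W Q w) {Φ : V → W} (hΦ : GaugeReversing P v Q w Φ) {x : V}
    (hx : x ∈ openCone P v) {δ : ℝ} (hδ : 0 < δ) :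
    ∀ᶠ s in 𝓝[>] (0 : ℝ), ∀ h, hV.seminorm hx h ≤ 1 →
      hW.seminorm (hΦ.mapsTo hx) ((Φ (x + s • h) - Φ x) + (Φ (x - s • h) - Φ x)) ≤ s * δ := by
  obtain ⟨n, hn⟩ : ∃ n : ℕ, ((1 : ℝ) / 2) ^ n < δ / 4 :=
    exists_pow_lt_of_lt_one (by linarith) (by norm_num)
  obtain ⟨Ψ, hΨ, hl, hr⟩ := hΦ.exists_inverse hV
  have hn0 : (0 : ℝ) ≤ n := n.cast_nonneg
  set R : ℝ := 4 * n + 9 with hRdef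
  have hR : 0 ≤ R := by positivity
  set ε : ℝ → ℝ := fun s => 2 * R * (((1 - s * R) ^ 2)⁻¹ - 1) with hεdef
  have hεt : Filter.Tendsto ε (𝓝[>] 0) (𝓝 0) := by
    have : ContinuousAt ε 0 := by
      refine ContinuousAt.mul continuousAt_const (ContinuousAt.sub (ContinuousAt.inv₀ ?_ ?_)
        continuousAt_const)
      · fun_prop
      · norm_num
    have h0 : ε 0 = 0 := by simp [hεdef]
    have := this.tendsto.mono_left (nhdsWithin_le_nhds (s := Set.Ioi 0))
    rwa [h0] at this
  have hst : Filter.Tendsto (fun s : ℝ => s * R) (𝓝[>] 0) (𝓝 0) := by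
    have : Continuous fun s : ℝ => s * R := by fun_prop
    have := this.tendsto 0
    rw [zero_mul] at this
    exact this.mono_left nhdsWithin_le_nhds
  have hpow : (0 : ℝ) < (1 / 2) ^ n := by positivity
  filter_upwards [self_mem_nhdsWithin, hst.eventually_lt_const one_pos,
    hεt.eventually_lt_const (half_pos hpow),
    hεt.eventually_lt_const (div_pos (half_pos hδ) (by positivity : (0 : ℝ) < 2 * n + 3))]
    with s hs hsR h1 h2 h hh
  have hs : 0 < s := hs
  have hε0 : 0 ≤ ε s := by
    have h5 : 0 < 1 - s * R := by linarith
    have : 1 ≤ ((1 - s * R) ^ 2)⁻¹ := by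
      rw [one_le_inv₀ (by positivity)]
      have : 0 ≤ s * R := by positivity
      nlinarith
    exact mul_nonneg (by linarith) (by linarith)
  have hyx : Ψ (Φ x) = x := hl x hx
  have hy := hΦ.mapsTo hx
  have hC : ∀ p, hV.seminorm hx p ≤ R → x + s • p ∈ openCone P v := by
    intro p hp
    refine hV.add_mem_openCone_of_seminorm_le hx (mul_nonneg hs.le hR) hsR ?_
    rw [map_smul_eq_mul, Real.norm_of_nonneg hs.le]; gcongr
  have hD : ∀ p, hW.seminorm hy p ≤ R → Φ x + s • p ∈ openCone Q w := by
    intro p hp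
    refine hW.add_mem_openCone_of_seminorm_le hy (mul_nonneg hs.le hR) hsR ?_
    rw [map_smul_eq_mul, Real.norm_of_nonneg hs.le]; gcongr
  have key := Seminorm.approx_isometry_midpoint (hV.seminorm hx) (hW.seminorm hy) n
    (fun p => s⁻¹ • (Φ (x + s • p) - Φ x)) (fun q => s⁻¹ • (Ψ (Φ x + s • q) - x)) hε0
    (by linarith)
    (fun p q hp hq => hΦ.rescaled_near_isometry hV hW hx hs hR hsR hp hq)
    (fun p q hp hq => by
      have := hΨ.rescaled_near_isometry hW hV hy hs hR hsR hp hq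
      simp only [hyx] at this
      exact this)
    (fun p hp => by
      rw [smul_inv_smul₀ hs.ne', add_sub_cancel, hl _ (hC p hp), add_sub_cancel_left,
        inv_smul_smul₀ hs.ne'])
    (fun p hp => by
      rw [smul_inv_smul₀ hs.ne', add_sub_cancel, hr _ (hD p hp), add_sub_cancel_left,
        inv_smul_smul₀ hs.ne'])
    (by simp) hh
  rw [← smul_add, map_smul_eq_mul, norm_inv, Real.norm_of_nonneg hs.le, smul_neg,
    ← sub_eq_add_neg, inv_mul_le_iff₀ hs] at key
  refine key.trans ?_
  gcongr
  rw [lt_div_iff₀ (by positivity)] at h2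
  linarith

end MazurUlam

section Differentiability

variable {V : Type*} [NormedAddCommGroup V] [NormedSpace ℝ V] {P : Set V} {v : V}
variable {W : Type*} [NormedAddCommGroup W] [NormedSpace ℝ W] {Q : Set W} {w : W}

theorem GaugeReversing.exists_lipschitz (hV : IsOrderUnitSpace V P v)
    (hW : IsOrderUnitSpace W Q w) {Φ : V → W} (hΦ : GaugeReversing P v Q w Φ) {x : V}
    (hx : x ∈ openCone P v) :
    ∃ L r : ℝ, 0 ≤ L ∧ 0 < r ∧ ∀ h k : V, ‖h‖ ≤ r → ‖k‖ ≤ r →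
      ‖Φ (x + h) - Φ (x + k)‖ ≤ L * ‖h - k‖ := by
  obtain ⟨ε, hε, hxε⟩ := id hx
  refine ⟨‖Φ x‖ * (4 * ε⁻¹), ε / 2, by positivity, by positivity, fun h k hh hk => ?_⟩
  have hn : ∀ z, hV.seminorm hx z ≤ ε⁻¹ * ‖z‖ := hV.seminorm_le_norm hε hxε
  have hle : ∀ z, ‖z‖ ≤ ε / 2 → hV.seminorm hx z ≤ 1 / 2 := fun z hz =>
    (hn z).trans (by rw [inv_mul_le_iff₀ hε]; linarith)
  have h1 := hΦ.seminorm_sub_le hV hW hx (by norm_num) (by norm_num) (hle h hh) (hle k hk)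
  have h2 := hW.norm_le_seminorm (hΦ.mapsTo hx) (Φ (x + h) - Φ (x + k))
  have h3 : hV.seminorm hx (h - k) / (1 - 1 / 2) ^ 2 = 4 * hV.seminorm hx (h - k) := by ring
  rw [h3] at h1
  calc _ ≤ ‖Φ x‖ * _ := h2
    _ ≤ ‖Φ x‖ * (4 * (ε⁻¹ * ‖h - k‖)) := by gcongr; exact h1.trans (by gcongr; exact hn _)
    _ = _ := by ring

theorem GaugeReversing.eventually_second_difference_le (hV : IsOrderUnitSpace V P v)
    (hW : IsOrderUnitSpace W Q w) {Φ : V → W} (hΦ : GaugeReversing P v Q w Φ) {x : V}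
    (hx : x ∈ openCone P v) {δ : ℝ} (hδ : 0 < δ) :
    ∀ᶠ h in 𝓝 (0 : V), ‖(Φ (x + h) - Φ x) + (Φ (x - h) - Φ x)‖ ≤ δ * ‖h‖ := by
  obtain ⟨ε, hε, hxε⟩ := id hx
  have hn : ∀ z, hV.seminorm hx z ≤ ε⁻¹ * ‖z‖ := hV.seminorm_le_norm hε hxε
  have hδ' : 0 < δ * ε / (‖Φ x‖ + 1) := by positivity
  obtain ⟨s₀, hs₀, hs⟩ := mem_nhdsGT_iff_exists_Ioo_subset.1
    (hΦ.second_difference_isLittleO hV hW hx hδ')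
  have hs₀ : 0 < s₀ := hs₀
  filter_upwards [Metric.ball_mem_nhds (0 : V) (mul_pos hε hs₀)] with h hh
  rw [mem_ball_zero_iff] at hh
  rcases eq_or_ne h 0 with rfl | h0
  · simp
  have hpos : 0 < ε⁻¹ * ‖h‖ := by have := norm_pos_iff.2 h0; positivity
  have h1 := hs ⟨hpos, by rwa [inv_mul_lt_iff₀ hε]⟩ ((ε⁻¹ * ‖h‖)⁻¹ • h) (by
    rw [map_smul_eq_mul, norm_inv, Real.norm_of_nonneg hpos.le, inv_mul_le_iff₀ hpos, mul_one]
    exact hn h)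
  rw [smul_inv_smul₀ hpos.ne'] at h1
  refine (hW.norm_le_seminorm (hΦ.mapsTo hx) _).trans ?_
  calc _ ≤ (‖Φ x‖ + 1) * (ε⁻¹ * ‖h‖ * (δ * ε / (‖Φ x‖ + 1))) := by gcongr; linarith
    _ = _ := by field_simp

theorem IsOrderUnitSpace.eventually_add_smul_mem (hV : IsOrderUnitSpace V P v) {x : V}
    (hx : x ∈ openCone P v) (h : V) : ∀ᶠ t in 𝓝[>] (0 : ℝ), x + t • h ∈ openCone P v := by
  have : Filter.Tendsto (fun t : ℝ => x + t • h) (𝓝 0) (𝓝 x) := by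
    have : Continuous fun t : ℝ => x + t • h := by fun_prop
    simpa using this.tendsto 0
  exact nhdsWithin_le_nhds (this.eventually_mem (hV.isOpen_openCone.mem_nhds hx))

theorem GaugeReversing.difference_quotient_mono (hV : IsOrderUnitSpace V P v)
    (hW : IsOrderUnitSpace W Q w) {Φ : V → W} (hΦ : GaugeReversing P v Q w Φ) {x h : V}
    (hx : x ∈ openCone P v) {s t : ℝ} (hs : 0 < s) (hst : s ≤ t)
    (ht : x + t • h ∈ openCone P v) :
    t⁻¹ • (Φ (x + t • h) - Φ x) - s⁻¹ • (Φ (x + s • h) - Φ x) ∈ Q := by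
  have ht0 : 0 < t := hs.trans_le hst
  have h1 := hΦ.convex hV hW hx ht (a := 1 - s / t) (b := s / t)
    (sub_nonneg.2 ((div_le_one ht0).2 hst)) (by positivity) (by ring)
  have h2 : (1 - s / t) • x + (s / t) • (x + t • h) = x + s • h := by
    rw [smul_add, smul_smul, div_mul_cancel₀ _ ht0.ne']; module
  rw [h2] at h1
  have := hW.smul_mem s⁻¹ (by positivity) _ h1
  convert this using 1
  have h3 : t⁻¹ = s⁻¹ * (s / t) := by field_simp
  rw [h3]; module

theorem GaugeReversing.neg_difference_quotient_le (hV : IsOrderUnitSpace V P v)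
    (hW : IsOrderUnitSpace W Q w) {Φ : V → W} (hΦ : GaugeReversing P v Q w Φ) {x h : V}
    {t : ℝ} (ht : 0 < t)
    (h1 : x + t • h ∈ openCone P v) (h2 : x - t • h ∈ openCone P v) :
    t⁻¹ • (Φ (x + t • h) - Φ x) + t⁻¹ • (Φ (x - t • h) - Φ x) ∈ Q := by
  have h3 := hΦ.convex hV hW h1 h2 (a := 1 / 2) (b := 1 / 2) (by norm_num) (by norm_num)
    (by norm_num)
  rw [show (1 / 2 : ℝ) • (x + t • h) + (1 / 2 : ℝ) • (x - t • h) = x by module] at h3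
  have := hW.smul_mem (2 * t⁻¹) (by positivity) _ h3
  convert this using 1; module

theorem GaugeReversing.exists_directional_derivative [CompleteSpace W]
    (hV : IsOrderUnitSpace V P v)
    (hW : IsOrderUnitSpace W Q w) {Φ : V → W} (hΦ : GaugeReversing P v Q w Φ) {x : V}
    (hx : x ∈ openCone P v) (h : V) :
    ∃ d : W, Filter.Tendsto (fun t : ℝ => t⁻¹ • (Φ (x + t • h) - Φ x)) (𝓝[>] 0) (𝓝 d) := by
  refine CompleteSpace.complete (f := Filter.map (fun t : ℝ => t⁻¹ • (Φ (x + t • h) - Φ x)) (𝓝[>] 0)) ?_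
  rw [Metric.cauchy_iff]
  refine ⟨inferInstance, fun ε hε => ?_⟩
  have hδ : 0 < ε / (3 * (‖h‖ + 1)) := by positivity
  have hsmall : Filter.Tendsto (fun t : ℝ => t • h) (𝓝[>] 0) (𝓝 0) := by
    have : Continuous fun t : ℝ => t • h := by fun_prop
    have := this.tendsto 0
    rw [zero_smul] at this
    exact this.mono_left nhdsWithin_le_nhds
  obtain ⟨t, ht1, ht2, ht3, ht0⟩ := ((hsmall.eventually
    (hΦ.eventually_second_difference_le hV hW hx hδ)).and
    ((hV.eventually_add_smul_mem hx h).and ((hV.eventually_add_smul_mem hx (-h)).and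
      self_mem_nhdsWithin))).exists
  have ht0 : 0 < t := ht0
  rw [smul_neg, ← sub_eq_add_neg] at ht3
  set q : ℝ → V → W := fun t h => t⁻¹ • (Φ (x + t • h) - Φ x) with hq
  have hbound : ‖q t h + q t (-h)‖ ≤ ε / 3 := by
    have : q t h + q t (-h) = t⁻¹ • ((Φ (x + t • h) - Φ x) + (Φ (x - t • h) - Φ x)) := by
      simp only [hq, smul_neg, ← sub_eq_add_neg, smul_add]
    rw [this, norm_smul, norm_inv, Real.norm_of_nonneg ht0.le, inv_mul_le_iff₀ ht0]
    refine ht1.trans ?_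
    rw [norm_smul, Real.norm_of_nonneg ht0.le]
    calc ε / (3 * (‖h‖ + 1)) * (t * ‖h‖) = t * (ε / 3) * (‖h‖ / (‖h‖ + 1)) := by
          field_simp
      _ ≤ t * (ε / 3) * 1 := by
          gcongr
          rw [div_le_one (by positivity)]; linarith
      _ = _ := by ring
  have hclose : ∀ s, 0 < s → s ≤ t → ‖q t h - q s h‖ ≤ ε / 3 := by
    intro s hs hst
    refine (hW.norm_le_of_mem (hΦ.difference_quotient_mono hV hW hx hs hst ht2) ?_).trans hbound
    have hs2 : ∀ k, x + t • k ∈ openCone P v → x + s • k ∈ openCone P v := by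
      intro k hk
      have := hV.convex_openCone hx hk (a := 1 - s / t) (b := s / t)
        (sub_nonneg.2 ((div_le_one ht0).2 hst)) (by positivity) (by ring)
      rw [smul_add, smul_smul, div_mul_cancel₀ _ ht0.ne'] at this
      convert this using 1; module
    have ht3' : x + t • -h ∈ openCone P v := by rwa [smul_neg, ← sub_eq_add_neg]
    have h1 := hΦ.difference_quotient_mono hV hW hx hs hst ht3'
    have h2 := hΦ.neg_difference_quotient_le hV hW hs (hs2 h ht2) (by
      have := hs2 (-h) ht3'; rwa [smul_neg, ← sub_eq_add_neg] at this)
    have := hW.add_mem _ h1 _ h2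
    convert this using 1
    simp only [hq, smul_neg, ← sub_eq_add_neg]
    abel
  refine ⟨(fun s => q s h) '' Set.Ioc 0 t, Filter.image_mem_map (Ioc_mem_nhdsGT ht0), ?_⟩
  rintro _ ⟨s, hs, rfl⟩ _ ⟨s', hs', rfl⟩
  have h1 := hclose s hs.1 hs.2
  have h2 := hclose s' hs'.1 hs'.2
  rw [dist_eq_norm]
  calc _ = ‖(q t h - q s' h) - (q t h - q s h)‖ := by congr 1; abel
    _ ≤ _ := norm_sub_le _ _
    _ < ε := by linarith

theorem GaugeReversing.differentiableAt [CompleteSpace W] (hV : IsOrderUnitSpace V P v)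
    (hW : IsOrderUnitSpace W Q w) {Φ : V → W} (hΦ : GaugeReversing P v Q w Φ) {x : V}
    (hx : x ∈ openCone P v) : DifferentiableAt ℝ Φ x := by
  choose D hD using hΦ.exists_directional_derivative hV hW hx
  have htt : ∀ c : ℝ, 0 < c → Filter.Tendsto (fun t : ℝ => c * t) (𝓝[>] 0) (𝓝[>] 0) := by
    intro c hc
    refine tendsto_nhdsWithin_iff.2 ⟨?_, ?_⟩
    · have : Continuous fun t : ℝ => c * t := by fun_prop
      have := this.tendsto 0
      rw [mul_zero] at this
      exact this.mono_left nhdsWithin_le_nhds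
    · filter_upwards [self_mem_nhdsWithin] with t ht
      exact mul_pos hc ht
  have hsmall : ∀ h : V, Filter.Tendsto (fun t : ℝ => t • h) (𝓝[>] 0) (𝓝 0) := by
    intro h
    have : Continuous fun t : ℝ => t • h := by fun_prop
    have := this.tendsto 0
    rw [zero_smul] at this
    exact this.mono_left nhdsWithin_le_nhds
  have hDneg : ∀ h, D (-h) = -D h := by
    intro h
    rw [eq_neg_iff_add_eq_zero]
    refine tendsto_nhds_unique ((hD (-h)).add (hD h)) ?_
    rw [Metric.tendsto_nhds]
    intro ε hε
    have hδ : 0 < ε / (‖h‖ + 1) := by positivity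
    filter_upwards [(hsmall h).eventually (hΦ.eventually_second_difference_le hV hW hx hδ),
      self_mem_nhdsWithin] with t ht ht0
    have ht0 : 0 < t := ht0
    rw [dist_zero_right, smul_neg, ← sub_eq_add_neg, ← smul_add, norm_smul, norm_inv,
      Real.norm_of_nonneg ht0.le, inv_mul_lt_iff₀ ht0, add_comm]
    refine ht.trans_lt ?_
    rw [norm_smul, Real.norm_of_nonneg ht0.le]
    calc ε / (‖h‖ + 1) * (t * ‖h‖) = t * ε * (‖h‖ / (‖h‖ + 1)) := by field_simp
      _ < t * ε * 1 := by
          gcongr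
          rw [div_lt_one (by positivity)]; linarith
      _ = _ := by ring
  have hDsub : ∀ h k, D h + D k - D (h + k) ∈ Q := by
    intro h k
    refine hW.isClosed_cone.mem_of_tendsto
      ((((hD h).comp (htt 2 two_pos)).add ((hD k).comp (htt 2 two_pos))).sub (hD (h + k))) ?_
    filter_upwards [(htt 2 two_pos).eventually (hV.eventually_add_smul_mem hx h),
      (htt 2 two_pos).eventually (hV.eventually_add_smul_mem hx k),
      self_mem_nhdsWithin] with t h1 h2 ht0
    have ht0 : 0 < t := ht0
    have h3 := hΦ.convex hV hW h1 h2 (a := 1 / 2) (b := 1 / 2) (by norm_num) (by norm_num)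
      (by norm_num)
    rw [show (1 / 2 : ℝ) • (x + (2 * t) • h) + (1 / 2 : ℝ) • (x + (2 * t) • k)
      = x + t • (h + k) by module] at h3
    have := hW.smul_mem t⁻¹ (by positivity) _ h3
    convert this using 1
    simp only [Function.comp_apply, mul_inv]
    module
  have hDadd : ∀ h k, D (h + k) = D h + D k := by
    intro h k
    have h1 := hDsub h k
    have h2 := hDsub (-h) (-k)
    rw [← neg_add, hDneg, hDneg, hDneg] at h2
    refine (sub_eq_zero.1 (hW.proper _ h1 ?_)).symm
    convert h2 using 1; abel
  have hub : ∀ h, x + h ∈ openCone P v → Φ (x + h) - Φ x - D h ∈ Q := by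
    intro h hh
    refine hW.isClosed_cone.mem_of_tendsto (tendsto_const_nhds.sub (hD h)) ?_
    filter_upwards [Ioc_mem_nhdsGT one_pos] with t ht
    have := hΦ.difference_quotient_mono hV hW hx (h := h) ht.1 ht.2 (by rwa [one_smul])
    rwa [inv_one, one_smul, one_smul] at this
  obtain ⟨L, r, hL, hr, hlip⟩ := hΦ.exists_lipschitz hV hW hx
  have hDb : ∀ h, ‖D h‖ ≤ L * ‖h‖ := by
    intro h
    refine le_of_tendsto (hD h).norm ?_
    filter_upwards [(hsmall h).eventually (Metric.closedBall_mem_nhds 0 hr),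
      self_mem_nhdsWithin] with t ht ht0
    have ht0 : 0 < t := ht0
    have := hlip (t • h) 0 (mem_closedBall_zero_iff.1 ht) (by simpa using hr.le)
    rw [add_zero, sub_zero, norm_smul, Real.norm_of_nonneg ht0.le] at this
    rw [norm_smul, norm_inv, Real.norm_of_nonneg ht0.le, inv_mul_le_iff₀ ht0]
    linarith
  let D' : V →+ W := AddMonoidHom.mk' D hDadd
  have hc : Continuous D' := AddMonoidHomClass.continuous_of_bound D' L hDb
  refine ⟨D'.toRealLinearMap hc, hasFDerivAt_iff_isLittleO_nhds_zero.2 ?_⟩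
  rw [Asymptotics.isLittleO_iff]
  intro δ hδ
  have hC : ∀ᶠ h in 𝓝 (0 : V), x + h ∈ openCone P v :=
    (continuous_const_add x).tendsto' 0 x (add_zero x) |>.eventually_mem
      (hV.isOpen_openCone.mem_nhds hx)
  have hC' : ∀ᶠ h in 𝓝 (0 : V), x + -h ∈ openCone P v :=
    (continuous_neg (G := V)).tendsto' 0 0 neg_zero |>.eventually hC
  filter_upwards [hΦ.eventually_second_difference_le hV hW hx hδ, hC, hC'] with h h1 h2 h3
  refine (hW.norm_le_of_mem (hub h h2) ?_).trans h1
  have := hub (-h) h3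
  rw [hDneg, ← sub_eq_add_neg] at this
  convert this using 1
  abel

theorem GaugeReversing.sub_sub_fderiv_mem [CompleteSpace W] (hV : IsOrderUnitSpace V P v)
    (hW : IsOrderUnitSpace W Q w) {Φ : V → W} (hΦ : GaugeReversing P v Q w Φ) {x h : V}
    (hx : x ∈ openCone P v) (hh : x + h ∈ openCone P v) :
    Φ (x + h) - Φ x - fderiv ℝ Φ x h ∈ Q := by
  have hd := (hΦ.differentiableAt hV hW hx).hasFDerivAt.hasLineDerivAt h
  have hd := hd.tendsto_slope_zero_right
  refine hW.isClosed_cone.mem_of_tendsto (tendsto_const_nhds.sub hd) ?_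
  filter_upwards [Ioc_mem_nhdsGT one_pos] with t ht
  have := hΦ.difference_quotient_mono hV hW hx (h := h) ht.1 ht.2 (by rwa [one_smul])
  simpa using this

theorem GaugeReversing.continuousAt_fderiv [CompleteSpace W] (hV : IsOrderUnitSpace V P v)
    (hW : IsOrderUnitSpace W Q w) {Φ : V → W} (hΦ : GaugeReversing P v Q w Φ) {x : V}
    (hx : x ∈ openCone P v) : ContinuousAt (fderiv ℝ Φ) x := by
  rw [Metric.continuousAt_iff']
  intro ε hε
  obtain ⟨L, r, hL, hr, hlip⟩ := hΦ.exists_lipschitz hV hW hx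
  have hd := (hΦ.differentiableAt hV hW hx).hasFDerivAt
  rw [hasFDerivAt_iff_isLittleO_nhds_zero, Asymptotics.isLittleO_iff] at hd
  obtain ⟨ρ, hρ, hd⟩ := Metric.eventually_nhds_iff_ball.1 (hd (by positivity : 0 < ε / 8))
  obtain ⟨τ, hτ, hC⟩ := Metric.mem_nhds_iff.1 (hV.isOpen_openCone.mem_nhds hx)
  set s := min (min r ρ) τ / 4 with hs
  have hs0 : 0 < s := by positivity
  have hsr : 4 * s ≤ r := by rw [hs]; linarith [min_le_left (min r ρ) τ, min_le_left r ρ]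
  have hsρ : 4 * s ≤ ρ := by rw [hs]; linarith [min_le_left (min r ρ) τ, min_le_right r ρ]
  have hsτ : 4 * s ≤ τ := by rw [hs]; linarith [min_le_right (min r ρ) τ]
  have hη : 0 < min s (ε * s / (16 * (L + 1))) := by positivity
  filter_upwards [Metric.ball_mem_nhds x hη] with z hz
  obtain ⟨y, rfl⟩ : ∃ y, z = x + y := ⟨z - x, by abel⟩
  rw [mem_ball_iff_norm, add_sub_cancel_left, lt_min_iff] at hz
  obtain ⟨hy1, hy2⟩ := hz
  have hLy : L * ‖y‖ ≤ ε * s / 16 := by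
    rw [lt_div_iff₀ (by positivity)] at hy2
    nlinarith [norm_nonneg y]
  have hball : ∀ k : V, ‖k‖ ≤ 2 * s → x + k ∈ openCone P v := fun k hk =>
    hC (by rw [mem_ball_iff_norm, add_sub_cancel_left]; linarith)
  have hest : ∀ k : V, ‖k‖ = s →
      ‖Φ (x + y + k) - Φ (x + y) - fderiv ℝ Φ x k‖ ≤ ε * s / 4 := by
    intro k hk
    have h1 := hd k (by rw [mem_ball_zero_iff, hk]; linarith)
    have h2 := hlip (y + k) k ((norm_add_le _ _).trans (by linarith)) (by linarith)
    have h3 := hlip y 0 (by linarith) (by simpa using hr.le)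
    rw [add_sub_cancel_right, ← add_assoc] at h2
    rw [sub_zero, add_zero] at h3
    have : Φ (x + y + k) - Φ (x + y) - fderiv ℝ Φ x k = (Φ (x + k) - Φ x - fderiv ℝ Φ x k)
      + ((Φ (x + y + k) - Φ (x + k)) - (Φ (x + y) - Φ x)) := by abel
    rw [this]
    refine (norm_add_le _ _).trans ?_
    have h4 := norm_sub_le (Φ (x + y + k) - Φ (x + k)) (Φ (x + y) - Φ x)
    rw [hk] at h1
    linarith
  have hkey : ∀ k : V, ‖k‖ = s → ‖(fderiv ℝ Φ (x + y) - fderiv ℝ Φ x) k‖ ≤ ε * s / 2 := by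
    intro k hk
    have hxy := hball y (by linarith)
    have h1 := hΦ.sub_sub_fderiv_mem hV hW (h := k) hxy (by
      rw [add_assoc]; exact hball _ ((norm_add_le _ _).trans (by linarith)))
    have h2 := hΦ.sub_sub_fderiv_mem hV hW (h := -k) hxy (by
      rw [add_assoc]; exact hball _ ((norm_add_le _ _).trans (by rw [norm_neg]; linarith)))
    have h3 := hest k hk
    have h4 := hest (-k) (by rwa [norm_neg])
    refine (hW.norm_le_add (a := -(Φ (x + y + -k) - Φ (x + y) - fderiv ℝ Φ x (-k)))
      (b := Φ (x + y + k) - Φ (x + y) - fderiv ℝ Φ x k) ?_ ?_).trans ?_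
    · convert h2 using 1
      simp only [map_neg, sub_apply]; abel
    · convert h1 using 1
      simp only [sub_apply]; abel
    · rw [norm_neg]; linarith
  rw [dist_eq_norm]
  refine lt_of_le_of_lt (ContinuousLinearMap.opNorm_le_of_unit_norm (C := ε / 2) (by positivity)
    fun k hk => ?_) (by linarith)
  have := hkey (s • k) (by rw [norm_smul, hk, Real.norm_of_nonneg hs0.le, mul_one])
  rw [map_smul, norm_smul, Real.norm_of_nonneg hs0.le] at this
  nlinarith

theorem GaugeReversing.neg_fderiv_mem [CompleteSpace W] (hV : IsOrderUnitSpace V P v)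
    (hW : IsOrderUnitSpace W Q w) {Φ : V → W} (hΦ : GaugeReversing P v Q w Φ) {x h : V}
    (hx : x ∈ openCone P v) (hh : h ∈ P) : -fderiv ℝ Φ x h ∈ Q := by
  have hd := (hΦ.differentiableAt hV hW hx).hasFDerivAt.hasLineDerivAt h
  refine hW.isClosed_cone.mem_of_tendsto hd.tendsto_slope_zero_right.neg ?_
  filter_upwards [hV.eventually_add_smul_mem hx h, self_mem_nhdsWithin] with t ht ht0
  have ht0 : 0 < t := ht0
  have := (hΦ.2.2 _ hx _ ht).1 (by rw [add_sub_cancel_left]; exact hV.smul_mem _ ht0.le _ hh)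
  have := hW.smul_mem t⁻¹ (by positivity) _ this
  convert this using 1
  module

theorem GaugeReversing.fderiv_self [CompleteSpace W] (hV : IsOrderUnitSpace V P v)
    (hW : IsOrderUnitSpace W Q w) {Φ : V → W} (hΦ : GaugeReversing P v Q w Φ) {x : V}
    (hx : x ∈ openCone P v) : fderiv ℝ Φ x x = -Φ x := by
  have hd := (hΦ.differentiableAt hV hW hx).hasFDerivAt
  have h1 : HasDerivAt (fun t : ℝ => Φ (t • x)) (fderiv ℝ Φ x x) 1 := by
    refine HasFDerivAt.comp_hasDerivAt (l := Φ) (f := fun t : ℝ => t • x) (1 : ℝ) ?_ ?_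
    · rwa [one_smul]
    · simpa using (hasDerivAt_id (1 : ℝ)).smul_const x
  have h2 : HasDerivAt (fun t : ℝ => t⁻¹ • Φ x) (-Φ x) 1 := by
    simpa using (hasDerivAt_inv (one_ne_zero (α := ℝ))).smul_const (Φ x)
  refine h1.unique (h2.congr_of_eventuallyEq ?_)
  filter_upwards [lt_mem_nhds one_pos] with t ht
  exact hΦ.2.1 x hx t ht

theorem GaugeReversing.fderiv_comp_fderiv [CompleteSpace V] [CompleteSpace W]
    (hV : IsOrderUnitSpace V P v) (hW : IsOrderUnitSpace W Q w) {Φ : V → W} {Ψ : W → V}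
    (hΦ : GaugeReversing P v Q w Φ) (hΨ : GaugeReversing Q w P v Ψ)
    (hl : ∀ x ∈ openCone P v, Ψ (Φ x) = x) {x : V} (hx : x ∈ openCone P v) :
    fderiv ℝ Ψ (Φ x) ∘L fderiv ℝ Φ x = ContinuousLinearMap.id ℝ V := by
  have h1 := (hΨ.differentiableAt hW hV (hΦ.mapsTo hx)).hasFDerivAt.comp x
    (hΦ.differentiableAt hV hW hx).hasFDerivAt
  refine h1.unique ((hasFDerivAt_id x).congr_of_eventuallyEq ?_)
  filter_upwards [hV.isOpen_openCone.mem_nhds hx] with y hy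
  exact hl y hy

end Differentiability

section Symmetries

variable {V : Type*} [NormedAddCommGroup V] [NormedSpace ℝ V] {P : Set V} {v : V}
variable {W : Type*} [NormedAddCommGroup W] [NormedSpace ℝ W] {Q : Set W} {w : W}

theorem GaugePreserving.sub_mem_of_hasFDerivAt_id (hV : IsOrderUnitSpace V P v) {F : V → V}
    (hF : GaugePreserving P v P v F) {x : V} (hx : x ∈ openCone P v)
    (hd : HasFDerivAt F (ContinuousLinearMap.id ℝ V) x) {z : V} (hz : z ∈ openCone P v) :
    F z - z ∈ P := by
  have hd := hd.hasLineDerivAt z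
  refine hV.isClosed_cone.mem_of_tendsto (tendsto_const_nhds.sub hd.tendsto_slope_zero_right) ?_
  filter_upwards [self_mem_nhdsWithin] with t ht0
  have ht0 : 0 < t := ht0
  have := hF.subadditive hV hV hx (hV.openCone_smul_mem hz ht0)
  rw [hF.2.1 z hz t ht0] at this
  have := hV.smul_mem t⁻¹ (by positivity) _ this
  convert this using 1
  simp only [smul_sub, smul_add, inv_smul_smul₀ ht0.ne']
  abel

theorem GaugeReversing.involutive_of_fderiv_eq_neg_id [CompleteSpace V]
    (hV : IsOrderUnitSpace V P v) {S : V → V} (hS : GaugeReversing P v P v S) {x : V}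
    (hx : x ∈ openCone P v) (hSx : S x = x)
    (hd : fderiv ℝ S x = -ContinuousLinearMap.id ℝ V) {z : V} (hz : z ∈ openCone P v) :
    S (S z) = z := by
  obtain ⟨R, hR, hl, hr⟩ := hS.exists_inverse hV
  have hRx : R x = x := by simpa [hSx] using hl x hx
  have hdR : fderiv ℝ R x = -ContinuousLinearMap.id ℝ V := by
    have := hS.fderiv_comp_fderiv hV hV hR hl hx
    rw [hSx, hd, ContinuousLinearMap.comp_neg, ContinuousLinearMap.comp_id] at this
    rw [← this, neg_neg]
  have key : ∀ F : V → V, GaugeReversing P v P v F → F x = x →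
      fderiv ℝ F x = -ContinuousLinearMap.id ℝ V → ∀ y ∈ openCone P v, F (F y) - y ∈ P := by
    intro F hF hFx hdF y hy
    have h1 := (hF.differentiableAt hV hV hx).hasFDerivAt
    have h2 : HasFDerivAt F (fderiv ℝ F x) (F x) := by rwa [hFx]
    have h3 := h2.comp x h1
    rw [hdF, ContinuousLinearMap.comp_neg, ContinuousLinearMap.comp_id, neg_neg] at h3
    exact (hF.comp hF).sub_mem_of_hasFDerivAt_id hV hx h3 hy
  have h1 := key S hS hSx hd z hz
  have h2 := key R hR hRx hdR _ (hS.mapsTo (hS.mapsTo hz))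
  rw [hl _ (hS.mapsTo hz), hl z hz] at h2
  refine sub_eq_zero.1 (hV.proper _ h1 ?_)
  rwa [neg_sub]

theorem IsOrderUnitSpace.linearMap_mem_openCone (hV : IsOrderUnitSpace V P v)
    (hW : IsOrderUnitSpace W Q w) {T : W →L[ℝ] V} (hT : ∀ y ∈ Q, T y ∈ P) {u : W}
    (hu : T u = v) {y : W} (hy : y ∈ openCone Q w) : T y ∈ openCone P v := by
  obtain ⟨r, hr, h⟩ := hW.exists_smul_sub_mem hy u
  have := hV.smul_mem r⁻¹ (by positivity) _ (hT _ h)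
  rw [map_sub, map_smul, hu, smul_sub, inv_smul_smul₀ hr.ne'] at this
  exact ⟨r⁻¹, by positivity, this⟩

theorem GaugeReversing.comp_continuousLinearEquiv (hV : IsOrderUnitSpace V P v)
    (hW : IsOrderUnitSpace W Q w) {Φ : V → W} (hΦ : GaugeReversing P v Q w Φ) (T : W ≃L[ℝ] V)
    (hT : ∀ y ∈ Q, T y ∈ P) (hT' : ∀ x ∈ P, T.symm x ∈ Q) :
    GaugeReversing P v P v (fun x => T (Φ x)) := by
  have h1 : ∀ y ∈ openCone Q w, T y ∈ openCone P v := fun y hy =>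
    hV.linearMap_mem_openCone hW (T := T.toContinuousLinearMap) hT (T.apply_symm_apply v) hy
  have h2 : ∀ x ∈ openCone P v, T.symm x ∈ openCone Q w := fun x hx =>
    hW.linearMap_mem_openCone hV (T := T.symm.toContinuousLinearMap) hT' (T.symm_apply_apply w) hx
  refine ⟨⟨fun x hx => h1 _ (hΦ.mapsTo hx), fun x hx y hy hxy => hΦ.1.2.1 hx hy (T.injective hxy),
    fun z hz => ?_⟩, fun x hx r hr => ?_, fun x hx y hy => ?_⟩
  · obtain ⟨x, hx, hxz⟩ := hΦ.1.2.2 (h2 z hz)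
    exact ⟨x, hx, by simp [hxz]⟩
  · simp only [hΦ.2.1 x hx r hr, map_smul]
  · rw [hΦ.2.2 x hx y hy, ← map_sub]
    exact ⟨hT _, fun h => by simpa using hT' _ h⟩

/-- `S` is a gauge-reversing involution of the open cone of `(V, P, v)` that fixes `e` and has
derivative `-1` there. -/
structure IsGaugeSymmetry (P : Set V) (v : V) (S : V → V) (e : V) : Prop where
  gaugeReversing : GaugeReversing P v P v S
  mem : e ∈ openCone P v
  map_self : S e = e
  involutive : ∀ z ∈ openCone P v, S (S z) = z
  fderiv_eq : fderiv ℝ S e = -ContinuousLinearMap.id ℝ V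

theorem GaugeReversing.exists_isGaugeSymmetry [CompleteSpace V] [CompleteSpace W]
    (hV : IsOrderUnitSpace V P v)
    (hW : IsOrderUnitSpace W Q w) {Φ : V → W} (hΦ : GaugeReversing P v Q w Φ) {x : V}
    (hx : x ∈ openCone P v) :
    ∃ T : W ≃L[ℝ] V, (∀ h, T.symm h = -fderiv ℝ Φ x h) ∧ (∀ y ∈ Q, T y ∈ P) ∧
      (∀ x ∈ P, T.symm x ∈ Q) ∧ IsGaugeSymmetry P v (fun z => T (Φ z)) x := by
  obtain ⟨Ψ, hΨ, hl, hr⟩ := hΦ.exists_inverse hV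
  have h1 := hΦ.fderiv_comp_fderiv hV hW hΨ hl hx
  have h2 := hΨ.fderiv_comp_fderiv hW hV hΦ hr (hΦ.mapsTo hx)
  rw [hl x hx] at h2
  have hA : ∀ h, fderiv ℝ Ψ (Φ x) (fderiv ℝ Φ x h) = h := fun h => DFunLike.congr_fun h1 h
  have hB : ∀ h, fderiv ℝ Φ x (fderiv ℝ Ψ (Φ x) h) = h := fun h => DFunLike.congr_fun h2 h
  let T : W ≃L[ℝ] V := ContinuousLinearEquiv.equivOfInverse (-fderiv ℝ Ψ (Φ x)) (-fderiv ℝ Φ x)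
    (fun y => by simp [hB]) (fun z => by simp [hA])
  have hTs : ∀ h, T.symm h = -fderiv ℝ Φ x h := fun h => rfl
  have hT : ∀ y ∈ Q, T y ∈ P := fun y hy => hΨ.neg_fderiv_mem hW hV (hΦ.mapsTo hx) hy
  have hT' : ∀ x ∈ P, T.symm x ∈ Q := fun y hy => hΦ.neg_fderiv_mem hV hW hx hy
  have hS := hΦ.comp_continuousLinearEquiv hV hW T hT hT'
  have hSx : T (Φ x) = x := by
    rw [← T.eq_symm_apply, hTs, hΦ.fderiv_self hV hW hx, neg_neg]
  have hd : fderiv ℝ (fun z => T (Φ z)) x = -ContinuousLinearMap.id ℝ V := by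
    have := T.toContinuousLinearMap.hasFDerivAt.comp x
      (hΦ.differentiableAt hV hW hx).hasFDerivAt
    refine HasFDerivAt.fderiv (this.congr_fderiv ?_)
    ext h
    have : fderiv ℝ Φ x h = T.symm (-h) := by rw [hTs, map_neg, neg_neg]
    simp [this]
  exact ⟨T, hTs, hT, hT', hS, hx, hSx, fun z hz => hS.involutive_of_fderiv_eq_neg_id hV hx hSx hd hz,
    hd⟩

/-- The quadratic representation attached to a gauge-reversing involution `S`. -/
noncomputable def quadRep (S : V → V) (a : V) : V →L[ℝ] V := -fderiv ℝ S (S a)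

namespace IsGaugeSymmetry

variable {S : V → V} {e a b : V}

theorem map_mem (hS : IsGaugeSymmetry P v S e) (ha : a ∈ openCone P v) : S a ∈ openCone P v :=
  hS.gaugeReversing.mapsTo ha

theorem quadRep_self (hS : IsGaugeSymmetry P v S e) : quadRep S e = 1 := by
  rw [quadRep, hS.map_self, hS.fderiv_eq, neg_neg]; rfl

theorem quadRep_map_mul_quadRep [CompleteSpace V] (hV : IsOrderUnitSpace V P v)
    (hS : IsGaugeSymmetry P v S e) (ha : a ∈ openCone P v) :
    quadRep S (S a) * quadRep S a = 1 := by
  have := hS.gaugeReversing.fderiv_comp_fderiv hV hV hS.gaugeReversing hS.involutive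
    (hS.map_mem ha)
  rw [quadRep, quadRep, neg_mul_neg]
  exact this

theorem quadRep_mul_quadRep_map [CompleteSpace V] (hV : IsOrderUnitSpace V P v)
    (hS : IsGaugeSymmetry P v S e) (ha : a ∈ openCone P v) :
    quadRep S a * quadRep S (S a) = 1 := by
  have := hS.quadRep_map_mul_quadRep hV (hS.map_mem ha)
  rwa [hS.involutive a ha] at this

theorem quadRep_mem [CompleteSpace V] (hV : IsOrderUnitSpace V P v)
    (hS : IsGaugeSymmetry P v S e) (ha : a ∈ openCone P v) {z : V} (hz : z ∈ P) :
    quadRep S a z ∈ P :=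
  hS.gaugeReversing.neg_fderiv_mem hV hV (hS.map_mem ha) hz

theorem quadRep_mem_openCone [CompleteSpace V] (hV : IsOrderUnitSpace V P v)
    (hS : IsGaugeSymmetry P v S e) (ha : a ∈ openCone P v) {z : V} (hz : z ∈ openCone P v) :
    quadRep S a z ∈ openCone P v :=
  hV.linearMap_mem_openCone hV (fun _ h => hS.quadRep_mem hV ha h)
    (DFunLike.congr_fun (hS.quadRep_mul_quadRep_map hV ha) v) hz

theorem quadRep_map_apply [CompleteSpace V] (hV : IsOrderUnitSpace V P v)
    (hS : IsGaugeSymmetry P v S e) (ha : a ∈ openCone P v) : quadRep S a (S a) = a := by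
  rw [quadRep, neg_apply, hS.gaugeReversing.fderiv_self hV hV (hS.map_mem ha), neg_neg,
    hS.involutive a ha]

theorem map_quadRep [CompleteSpace V] (hV : IsOrderUnitSpace V P v)
    (hS : IsGaugeSymmetry P v S e) (ha : a ∈ openCone P v) {z : V} (hz : z ∈ openCone P v) :
    S (quadRep S a z) = quadRep S (S a) (S z) := by
  obtain ⟨T, hTs, hT, hT', hS'⟩ := hS.gaugeReversing.exists_isGaugeSymmetry hV hV ha
  have h1 : ∀ y, T.symm y = quadRep S (S a) y := by
    intro y; rw [hTs, quadRep, hS.involutive a ha, neg_apply]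
  have h2 : ∀ y, T y = quadRep S a y := by
    intro y
    rw [← T.eq_symm_apply, h1]
    exact (DFunLike.congr_fun (hS.quadRep_map_mul_quadRep hV ha) y).symm
  have := hS'.involutive (S z) (hS.map_mem hz)
  simp only [hS.involutive z hz] at this
  rw [← h1, ← h2, T.eq_symm_apply, this]

theorem quadRep_quadRep [CompleteSpace V] (hV : IsOrderUnitSpace V P v)
    (hS : IsGaugeSymmetry P v S e) (ha : a ∈ openCone P v) (hb : b ∈ openCone P v) :
    quadRep S (quadRep S a b) = quadRep S a * quadRep S b * quadRep S a := by
  have ha' := hS.map_mem ha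
  have hb' := hS.map_mem hb
  have hd : ∀ z ∈ openCone P v, HasFDerivAt S (fderiv ℝ S z) z := fun z hz =>
    (hS.gaugeReversing.differentiableAt hV hV hz).hasFDerivAt
  have h1 : HasFDerivAt (fun z => S (quadRep S (S a) z))
      (fderiv ℝ S (quadRep S (S a) (S b)) ∘L quadRep S (S a)) (S b) :=
    (hd _ (hS.quadRep_mem_openCone hV ha' hb')).comp _ (quadRep S (S a)).hasFDerivAt
  have h2 : HasFDerivAt (fun z => quadRep S a (S z)) (quadRep S a ∘L fderiv ℝ S (S b)) (S b) :=
    (quadRep S a).hasFDerivAt.comp _ (hd _ hb')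
  have h3 := h1.unique (h2.congr_of_eventuallyEq (by
    filter_upwards [hV.isOpen_openCone.mem_nhds hb'] with z hz
    rw [hS.map_quadRep hV ha' hz, hS.involutive a ha]))
  rw [← hS.map_quadRep hV ha hb] at h3
  have h4 : quadRep S (quadRep S a b) * quadRep S (S a) = quadRep S a * quadRep S b := by
    rw [quadRep, quadRep.eq_1 S b, neg_mul, mul_neg]
    exact congrArg Neg.neg h3
  rw [← h4, mul_assoc, hS.quadRep_map_mul_quadRep hV ha, mul_one]

theorem quadRep_pow_mem_openCone [CompleteSpace V] (hV : IsOrderUnitSpace V P v)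
    (hS : IsGaugeSymmetry P v S e) (ha : a ∈ openCone P v) (m : ℕ) :
    (quadRep S a ^ m) e ∈ openCone P v := by
  induction m with
  | zero => exact hS.mem
  | succ m ih =>
    rw [pow_succ']
    exact hS.quadRep_mem_openCone hV ha ih

theorem quadRep_quadRep_pow [CompleteSpace V] (hV : IsOrderUnitSpace V P v)
    (hS : IsGaugeSymmetry P v S e) (ha : a ∈ openCone P v) (m : ℕ) :
    quadRep S ((quadRep S a ^ m) e) = quadRep S a ^ (2 * m) := by
  induction m with
  | zero => simpa using hS.quadRep_self
  | succ m ih =>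
    have := hS.quadRep_quadRep hV ha (hS.quadRep_pow_mem_openCone hV ha m)
    rw [ih] at this
    rw [pow_succ']
    refine this.trans ?_
    rw [← pow_succ', ← pow_succ]; ring_nf

theorem map_quadRep_pow [CompleteSpace V] (hV : IsOrderUnitSpace V P v)
    (hS : IsGaugeSymmetry P v S e) (ha : a ∈ openCone P v) (m : ℕ) :
    S ((quadRep S a ^ m) e) = (quadRep S (S a) ^ m) e := by
  induction m with
  | zero => exact hS.map_self
  | succ m ih =>
    rw [pow_succ', pow_succ']
    refine (hS.map_quadRep hV ha (hS.quadRep_pow_mem_openCone hV ha m)).trans ?_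
    rw [ih]; rfl

theorem continuousAt (hV : IsOrderUnitSpace V P v) [CompleteSpace V]
    (hS : IsGaugeSymmetry P v S e) (ha : a ∈ openCone P v) : ContinuousAt S a :=
  (hS.gaugeReversing.differentiableAt hV hV ha).continuousAt

theorem continuousAt_quadRep [CompleteSpace V] (hV : IsOrderUnitSpace V P v)
    (hS : IsGaugeSymmetry P v S e) : ContinuousAt (quadRep S) e := by
  have h1 : ContinuousAt (fderiv ℝ S) (S e) :=
    hS.gaugeReversing.continuousAt_fderiv hV hV (hS.map_mem hS.mem)
  exact (h1.comp (hS.continuousAt hV hS.mem)).neg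

end IsGaugeSymmetry

end Symmetries

section AlmostAdditive

variable {E F : Type*} [NormedAddCommGroup E] [NormedSpace ℝ E]
variable [NormedAddCommGroup F] [NormedSpace ℝ F]

theorem exists_hasFDerivAt_zero_of_almost_additive [CompleteSpace F] {f : E → F}
    (h1 : f =O[𝓝 0] fun h => h)
    (h2 : (fun p : E × E => f (p.1 + p.2) - f p.1 - f p.2) =O[𝓝 0] fun p => ‖p‖ ^ 2) :
    ∃ L : E →L[ℝ] F, HasFDerivAt f L 0 := by
  obtain ⟨C₁, hC₁, h1⟩ := h1.exists_pos
  obtain ⟨C₂, hC₂, h2⟩ := h2.exists_pos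
  obtain ⟨r₁, hr₁, h1⟩ := Metric.eventually_nhds_iff_ball.1 h1.bound
  obtain ⟨r₂, hr₂, h2⟩ := Metric.eventually_nhds_iff_ball.1 h2.bound
  set r := min r₁ r₂ with hr
  have hr0 : 0 < r := lt_min hr₁ hr₂
  have h1 : ∀ h, ‖h‖ < r → ‖f h‖ ≤ C₁ * ‖h‖ := fun h hh =>
    h1 h (mem_ball_zero_iff.2 (hh.trans_le (min_le_left _ _)))
  have h2 : ∀ h k, ‖h‖ < r → ‖k‖ < r → ‖f (h + k) - f h - f k‖ ≤ C₂ * max ‖h‖ ‖k‖ ^ 2 := by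
    intro h k hh hk
    have := h2 (h, k) (mem_ball_zero_iff.2 (by
      rw [Prod.norm_mk]; exact (max_lt hh hk).trans_le (min_le_right _ _)))
    rwa [Real.norm_of_nonneg (by positivity), Prod.norm_mk] at this
  have hf0 : f 0 = 0 := by simpa using h1 0 (by simpa using hr0)
  set s : E → ℕ → F := fun h n => (2 : ℝ) ^ n • f ((2 ^ n : ℝ)⁻¹ • h) with hs
  have hscale : ∀ (n : ℕ) (h : E), ‖(2 ^ n : ℝ)⁻¹ • h‖ = (2 ^ n)⁻¹ * ‖h‖ := by
    intro n h; rw [norm_smul, Real.norm_of_nonneg (by positivity)]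
  have hle : ∀ (n : ℕ) (h : E), ‖(2 ^ n : ℝ)⁻¹ • h‖ ≤ ‖h‖ := by
    intro n h
    rw [hscale]
    exact mul_le_of_le_one_left (norm_nonneg _) (inv_le_one_of_one_le₀ (one_le_pow₀ one_le_two))
  have hgeom : ∀ h, ‖h‖ < r → ∀ n, dist (s h n) (s h (n + 1)) ≤ C₂ * ‖h‖ ^ 2 / 2 / 2 ^ n := by
    intro h hh n
    have h3 := h2 ((2 ^ (n + 1) : ℝ)⁻¹ • h) ((2 ^ (n + 1) : ℝ)⁻¹ • h) ((hle _ _).trans_lt hh)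
      ((hle _ _).trans_lt hh)
    rw [max_self, ← two_smul ℝ ((2 ^ (n + 1) : ℝ)⁻¹ • h), smul_smul,
      show (2 : ℝ) * (2 ^ (n + 1))⁻¹ = (2 ^ n)⁻¹ by rw [pow_succ]; field_simp, hscale] at h3
    have h4 : s h n - s h (n + 1) = (2 : ℝ) ^ n •
        (f ((2 ^ n : ℝ)⁻¹ • h) - f ((2 ^ (n + 1) : ℝ)⁻¹ • h) - f ((2 ^ (n + 1) : ℝ)⁻¹ • h)) := by
      simp only [hs]; rw [pow_succ]; module
    rw [dist_eq_norm, h4, norm_smul, Real.norm_of_nonneg (by positivity)]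
    calc _ ≤ (2 : ℝ) ^ n * (C₂ * ((2 ^ (n + 1))⁻¹ * ‖h‖) ^ 2) := by gcongr
      _ = C₂ * ‖h‖ ^ 2 / 2 / 2 ^ n / 2 := by field_simp; ring
      _ ≤ _ := half_le_self (by positivity)
  have hlim : ∀ h, ∃ l, Filter.Tendsto (s h) Filter.atTop (𝓝 l) := by
    intro h
    have hsmall : Filter.Tendsto (fun n : ℕ => (2 ^ n : ℝ)⁻¹ * ‖h‖) Filter.atTop (𝓝 0) := by
      have := (tendsto_pow_atTop_nhds_zero_of_lt_one (r := (2 : ℝ)⁻¹) (by norm_num)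
        (by norm_num)).mul_const ‖h‖
      simpa using this
    obtain ⟨m, hm⟩ := (hsmall.eventually_lt_const hr0).exists
    rw [← hscale] at hm
    obtain ⟨l, hl⟩ := cauchySeq_tendsto_of_complete (cauchySeq_of_le_geometric_two (hgeom _ hm))
    refine ⟨(2 : ℝ) ^ m • l, (Filter.tendsto_add_atTop_iff_nat m).1 ?_⟩
    refine (hl.const_smul ((2 : ℝ) ^ m)).congr fun n => ?_
    simp only [hs, smul_smul]
    rw [pow_add, mul_inv, mul_comm (2 ^ m : ℝ)]
  choose L hL using hlim
  have htend : ∀ h : E, Filter.Tendsto (fun n : ℕ => (2 ^ n : ℝ)⁻¹ * ‖h‖) Filter.atTop (𝓝 0) := by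
    intro h
    have := (tendsto_pow_atTop_nhds_zero_of_lt_one (r := (2 : ℝ)⁻¹) (by norm_num)
      (by norm_num)).mul_const ‖h‖
    simpa using this
  have hadd : ∀ h k, L (h + k) = L h + L k := by
    intro h k
    rw [← sub_eq_zero, ← sub_sub]
    refine tendsto_nhds_unique (((hL (h + k)).sub (hL h)).sub (hL k)) ?_
    refine squeeze_zero_norm' (a := fun n : ℕ => C₂ * max ‖h‖ ‖k‖ ^ 2 * (2⁻¹) ^ n) ?_ ?_
    · filter_upwards [(htend h).eventually_lt_const hr0, (htend k).eventually_lt_const hr0]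
        with n hn hn'
      rw [← hscale] at hn hn'
      have h3 := h2 _ _ hn hn'
      rw [← smul_add, hscale, hscale, ← mul_max_of_nonneg _ _ (by positivity)] at h3
      simp only [hs, ← smul_sub]
      rw [norm_smul, Real.norm_of_nonneg (by positivity)]
      calc _ ≤ (2 : ℝ) ^ n * (C₂ * ((2 ^ n)⁻¹ * max ‖h‖ ‖k‖) ^ 2) := by gcongr
        _ = C₂ * max ‖h‖ ‖k‖ ^ 2 * ((2 ^ n * (2 ^ n : ℝ)⁻¹) * (2 ^ n)⁻¹) := by ring
        _ = _ := by rw [mul_inv_cancel₀ (by positivity), one_mul, inv_pow]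
    · simpa using (tendsto_pow_atTop_nhds_zero_of_lt_one (r := (2 : ℝ)⁻¹) (by norm_num)
        (by norm_num)).const_mul (C₂ * max ‖h‖ ‖k‖ ^ 2)
  have hbd : ∀ h, ‖L h‖ ≤ C₁ * ‖h‖ := by
    intro h
    refine le_of_tendsto (hL h).norm ?_
    filter_upwards [(htend h).eventually_lt_const hr0] with n hn
    rw [← hscale] at hn
    have h3 := h1 _ hn
    rw [hscale] at h3
    simp only [hs]
    rw [norm_smul, Real.norm_of_nonneg (by positivity)]
    calc _ ≤ (2 : ℝ) ^ n * (C₁ * ((2 ^ n)⁻¹ * ‖h‖)) := by gcongr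
      _ = _ := by field_simp
  let L' : E →+ F := AddMonoidHom.mk' L hadd
  have hc : Continuous L' := AddMonoidHomClass.continuous_of_bound L' C₁ hbd
  refine ⟨L'.toRealLinearMap hc, hasFDerivAt_iff_isLittleO_nhds_zero.2 ?_⟩
  have hO : (fun h => f (0 + h) - f 0 - L'.toRealLinearMap hc h) =O[𝓝 0] fun h => ‖h‖ ^ 2 := by
    refine Asymptotics.IsBigO.of_bound C₂ ?_
    filter_upwards [Metric.ball_mem_nhds (0 : E) hr0] with h hh
    rw [mem_ball_zero_iff] at hh
    have := dist_le_of_le_geometric_two_of_tendsto₀ (hgeom h hh) (hL h)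
    rw [dist_eq_norm] at this
    rw [zero_add, hf0, sub_zero, Real.norm_of_nonneg (by positivity)]
    have h0 : s h 0 = f h := by simp [hs]
    rwa [h0] at this
  exact hO.trans_isLittleO (Asymptotics.isLittleO_norm_pow_id one_lt_two)

end AlmostAdditive

section PowerBounds

theorem norm_sub_one_le_of_norm_pow_sub_one_le {A : Type*} [NormedRing A] [NormedAlgebra ℝ A]
    {g : A} {N : ℕ} (h : ∀ m ≤ N, ‖g ^ m - 1‖ ≤ 1 / 2) : N * ‖g - 1‖ ≤ 1 := by
  have h1 : (N : ℝ) • (g - 1) = g ^ N - 1 - (g - 1) * ∑ i ∈ Finset.range N, (g ^ i - 1) := by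
    rw [Finset.sum_sub_distrib, mul_sub, mul_geom_sum]
    simp [Nat.cast_smul_eq_nsmul, nsmul_eq_mul, sub_mul, mul_sub, Nat.cast_comm]
  have h2 : ‖∑ i ∈ Finset.range N, (g ^ i - 1)‖ ≤ N * (1 / 2) := by
    refine (norm_sum_le_of_le _ fun i hi => h i (Finset.mem_range.1 hi).le).trans ?_
    simp
  have h3 := norm_sub_le (g ^ N - 1) ((g - 1) * ∑ i ∈ Finset.range N, (g ^ i - 1))
  rw [← h1, norm_smul, Real.norm_of_nonneg N.cast_nonneg] at h3
  have h4 := norm_mul_le (g - 1) (∑ i ∈ Finset.range N, (g ^ i - 1))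
  have h5 := h N le_rfl
  have h6 := mul_le_mul_of_nonneg_left h2 (norm_nonneg (g - 1))
  nlinarith

theorem one_add_pow_le_one_add_two_mul {c : ℝ} (hc : 0 ≤ c) (m : ℕ) (hm : m * c ≤ 1 / 2) :
    (1 + c) ^ m ≤ 1 + 2 * m * c := by
  induction m with
  | zero => simp
  | succ m ih =>
    push_cast at hm ⊢
    have := ih (by nlinarith)
    rw [pow_succ]
    nlinarith [mul_le_mul_of_nonneg_right this (by linarith : 0 ≤ 1 + c)]

variable {V : Type*} [NormedAddCommGroup V] [NormedSpace ℝ V] {P : Set V} {v : V}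

theorem IsOrderUnitSpace.seminorm_pow_apply_sub_le (hV : IsOrderUnitSpace V P v) {e : V}
    (he : e ∈ openCone P v) {T : V →L[ℝ] V} (hT : ∀ z ∈ P, T z ∈ P) {c : ℝ}
    (hc : hV.seminorm he (T e - e) ≤ c) (m : ℕ) (hm : m * c ≤ 1 / 2) (hc1 : c ≤ 1) :
    hV.seminorm he ((T ^ m) e - e) ≤ 2 * m * c := by
  have hc0 : 0 ≤ c := (apply_nonneg _ _).trans hc
  obtain ⟨h1, h2⟩ := (hV.seminorm_le_iff he hc0).1 hc
  have hup : ∀ n : ℕ, (1 + c) ^ n • e - (T ^ n) e ∈ P ∧ (T ^ n) e - (1 - c) ^ n • e ∈ P := by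
    intro n
    induction n with
    | zero => simpa using hV.zero_mem
    | succ n ih =>
      rw [pow_succ' T]
      have a1 := hT _ ih.1
      have a2 := hT _ ih.2
      rw [map_sub, map_smul] at a1 a2
      constructor
      · have := hV.add_mem _ a1 _ (hV.smul_mem ((1 + c) ^ n) (by positivity) _ h2)
        convert this using 1
        rw [pow_succ, mul_apply_eq_comp]; module
      · have := hV.add_mem _ a2 _ (hV.smul_mem ((1 - c) ^ n) (pow_nonneg (by linarith) _) _ h1)
        convert this using 1
        rw [pow_succ, mul_apply_eq_comp]; module
  refine (hV.seminorm_le_iff he (by positivity)).2 ⟨?_, ?_⟩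
  · have h3 : 1 - 2 * m * c ≤ (1 - c) ^ m := by
      have := one_add_mul_le_pow (a := -c) (by linarith) m
      rw [← sub_eq_add_neg] at this
      have : 0 ≤ m * c := by positivity
      linarith
    have := hV.add_mem _ (hup m).2 _ (hV.smul_sub_smul_mem h3 (hV.openCone_subset he))
    convert this using 1; module
  · have h3 := one_add_pow_le_one_add_two_mul hc0 m hm
    have := hV.add_mem _ (hup m).1 _ (hV.smul_sub_smul_mem h3 (hV.openCone_subset he))
    convert this using 1; module

end PowerBounds

namespace IsGaugeSymmetry

variable {V : Type*} [NormedAddCommGroup V] [NormedSpace ℝ V] {P : Set V} {v : V}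
variable {S : V → V} {e : V}

theorem eventually_add_mem (hV : IsOrderUnitSpace V P v) (hS : IsGaugeSymmetry P v S e) :
    ∀ᶠ h in 𝓝 (0 : V), e + h ∈ openCone P v :=
  (continuous_const_add e).tendsto' 0 e (add_zero e) |>.eventually_mem
    (hV.isOpen_openCone.mem_nhds hS.mem)

variable [CompleteSpace V]

theorem isBigO_map_sub (hV : IsOrderUnitSpace V P v) (hS : IsGaugeSymmetry P v S e) :
    (fun h => S (e + h) - e) =O[𝓝 0] fun h => h := by
  have h1 := (hS.gaugeReversing.differentiableAt hV hV hS.mem).hasFDerivAt.isBigO_sub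
  have h2 : Filter.Tendsto (fun h => e + h) (𝓝 0) (𝓝 e) :=
    (continuous_const_add e).tendsto' 0 e (add_zero e)
  simpa [Function.comp_def, hS.map_self] using h1.comp_tendsto h2

theorem tendsto_quadRep (hV : IsOrderUnitSpace V P v) (hS : IsGaugeSymmetry P v S e) :
    Filter.Tendsto (fun h => quadRep S (e + h)) (𝓝 0) (𝓝 1) := by
  have h2 : Filter.Tendsto (fun h => e + h) (𝓝 0) (𝓝 e) :=
    (continuous_const_add e).tendsto' 0 e (add_zero e)
  have := (hS.continuousAt_quadRep hV).tendsto.comp h2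
  rwa [hS.quadRep_self] at this

theorem isBigO_quadRep_apply_sub (hV : IsOrderUnitSpace V P v) (hS : IsGaugeSymmetry P v S e) :
    (fun h => quadRep S (e + h) e - e) =O[𝓝 0] fun h => h := by
  have h1 : (fun h => quadRep S (e + h) (S (e + h) - e)) =O[𝓝 0] fun h => h := by
    refine Asymptotics.IsBigO.trans ?_ (hS.isBigO_map_sub hV)
    refine Asymptotics.IsBigO.of_bound (‖(1 : V →L[ℝ] V)‖ + 1) ?_
    filter_upwards [(hS.tendsto_quadRep hV).norm.eventually_lt_const (lt_add_one _)] with h hh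
    exact ((quadRep S (e + h)).le_opNorm _).trans (by gcongr)
  refine ((Asymptotics.isBigO_refl (fun h : V => h) (𝓝 0)).sub h1).congr' ?_ Filter.EventuallyEq.rfl
  filter_upwards [hS.eventually_add_mem hV] with h hh
  rw [map_sub, hS.quadRep_map_apply hV hh]
  abel

theorem isBigO_quadRep_sub_one (hV : IsOrderUnitSpace V P v) (hS : IsGaugeSymmetry P v S e) :
    (fun h => quadRep S (e + h) - 1) =O[𝓝 0] fun h => h := by
  obtain ⟨K, hK, hKb⟩ := (hS.isBigO_quadRep_apply_sub hV).exists_pos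
  obtain ⟨ε, hε, heε⟩ := id hS.mem
  have hsn := hV.seminorm_le_norm hε heε
  have hhalf : ∀ᶠ h in 𝓝 (0 : V), ‖quadRep S (e + h) - 1‖ ≤ 1 / 2 := by
    filter_upwards [(hS.tendsto_quadRep hV).eventually (Metric.closedBall_mem_nhds 1 one_half_pos)]
      with h hh
    rwa [← dist_eq_norm]
  obtain ⟨ρ, hρ, hball⟩ := Metric.eventually_nhds_iff_ball.1 hhalf
  set c₀ : ℝ := min (1 / 2) (ρ / (4 * (‖e‖ + 1))) with hc₀
  have hc₀0 : 0 < c₀ := by positivity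
  have hc₀1 : c₀ ≤ 1 / 2 := min_le_left _ _
  have hc₀2 : c₀ * (4 * (‖e‖ + 1)) ≤ ρ := by
    rw [← le_div_iff₀ (by positivity)]; exact min_le_right _ _
  refine Asymptotics.IsBigO.of_bound (2 * (ε⁻¹ * K) / c₀) ?_
  have hsmall : ∀ᶠ h in 𝓝 (0 : V), ε⁻¹ * K * ‖h‖ < c₀ := by
    have : Continuous fun h : V => ε⁻¹ * K * ‖h‖ := by fun_prop
    exact (this.tendsto' 0 0 (by simp)).eventually_lt_const hc₀0
  filter_upwards [hKb.bound, hhalf, hsmall, hS.eventually_add_mem hV] with h h1 h2 h3 h4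
  rcases eq_or_ne h 0 with rfl | h0
  · simp [hS.quadRep_self]
  set T := quadRep S (e + h) with hT
  set c := ε⁻¹ * K * ‖h‖ with hc
  have hcpos : 0 < c := by have := norm_pos_iff.2 h0; positivity
  have hTe : hV.seminorm hS.mem (T e - e) ≤ c := by
    refine (hsn _).trans ?_
    rw [hc, mul_assoc]; gcongr
  have hpow : ∀ m ≤ ⌊c₀ / c⌋₊, ‖(T ^ 2) ^ m - 1‖ ≤ 1 / 2 := by
    intro m hm
    have hmc : m * c ≤ c₀ := by
      rw [← le_div_iff₀ hcpos]
      exact (Nat.le_floor_iff (by positivity)).1 hm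
    have h5 := hV.seminorm_pow_apply_sub_le hS.mem (fun z hz => hS.quadRep_mem hV h4 hz) hTe m
      (hmc.trans hc₀1) (by linarith)
    have h6 := hball ((T ^ m) e - e) (by
      rw [mem_ball_zero_iff]
      refine (hV.norm_le_seminorm hS.mem _).trans_lt ?_
      calc _ ≤ ‖e‖ * (2 * m * c) := by gcongr
        _ ≤ ‖e‖ * (2 * c₀) := mul_le_mul_of_nonneg_left (by linarith) (norm_nonneg e)
        _ < c₀ * (4 * (‖e‖ + 1)) := by nlinarith [norm_nonneg e]
        _ ≤ ρ := hc₀2)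
    rwa [add_sub_cancel, hS.quadRep_quadRep_pow hV h4, pow_mul] at h6
  have h5 := norm_sub_one_le_of_norm_pow_sub_one_le hpow
  have h6 : c₀ / c ≤ 2 * (⌊c₀ / c⌋₊ : ℝ) := by
    have h7 : (1 : ℝ) ≤ ⌊c₀ / c⌋₊ := by
      exact_mod_cast (Nat.one_le_floor_iff _).2 ((one_le_div hcpos).2 h3.le)
    have h8 := Nat.lt_floor_add_one (c₀ / c)
    linarith
  have h7 : ‖T - 1‖ ≤ ‖T ^ 2 - 1‖ := by
    have h8 : (2 : ℝ) • (T - 1) = (T ^ 2 - 1) - (T - 1) * (T - 1) := by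
      rw [two_smul]; noncomm_ring
    have h9 := norm_sub_le (T ^ 2 - 1) ((T - 1) * (T - 1))
    rw [← h8, norm_smul, Real.norm_of_nonneg zero_le_two] at h9
    have h10 := norm_mul_le (T - 1) (T - 1)
    nlinarith [norm_nonneg (T - 1)]
  have h8 : c₀ / c * ‖T ^ 2 - 1‖ ≤ 2 := by
    nlinarith [mul_le_mul_of_nonneg_right h6 (norm_nonneg (T ^ 2 - 1))]
  calc ‖T - 1‖ ≤ ‖T ^ 2 - 1‖ := h7
    _ = c / c₀ * (c₀ / c * ‖T ^ 2 - 1‖) := by field_simp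
    _ ≤ c / c₀ * 2 := by gcongr
    _ = _ := by rw [hc]; ring

theorem isBigO_map_sub_add (hV : IsOrderUnitSpace V P v) (hS : IsGaugeSymmetry P v S e) :
    (fun h => S (e + h) - e + h) =O[𝓝 0] fun h => ‖h‖ ^ 2 := by
  have h1 : (fun h => fderiv ℝ S (e + h) + 1) =O[𝓝 0] fun h => h := by
    have ht : Filter.Tendsto (fun h => S (e + h) - e) (𝓝 0) (𝓝 0) :=
      (hS.isBigO_map_sub hV).trans_tendsto Filter.tendsto_id
    refine (((hS.isBigO_quadRep_sub_one hV).comp_tendsto ht).trans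
      (hS.isBigO_map_sub hV)).neg_left.congr' ?_ Filter.EventuallyEq.rfl
    filter_upwards [hS.eventually_add_mem hV] with h hh
    simp only [Function.comp_apply]
    rw [add_sub_cancel, quadRep, hS.involutive _ hh]
    abel
  obtain ⟨C, hC, h1⟩ := h1.exists_pos
  obtain ⟨r, hr, h1⟩ := Metric.eventually_nhds_iff_ball.1 (h1.bound.and (hS.eventually_add_mem hV))
  refine Asymptotics.IsBigO.of_bound C ?_
  filter_upwards [Metric.ball_mem_nhds (0 : V) hr] with h hh
  rw [mem_ball_zero_iff] at hh
  have hmem : ∀ x ∈ Metric.closedBall e ‖h‖, ‖fderiv ℝ S x + 1‖ ≤ C * ‖h‖ ∧ x ∈ openCone P v := by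
    intro x hx
    rw [mem_closedBall_iff_norm] at hx
    have := h1 (x - e) (mem_ball_zero_iff.2 (hx.trans_lt hh))
    rw [add_sub_cancel] at this
    exact ⟨this.1.trans (by gcongr), this.2⟩
  have := (convex_closedBall e ‖h‖).norm_image_sub_le_of_norm_hasFDerivWithin_le' (f := S)
    (f' := fderiv ℝ S) (φ := -1) (C := C * ‖h‖)
    (fun x hx => (hS.gaugeReversing.differentiableAt hV hV (hmem x hx).2).hasFDerivAt.hasFDerivWithinAt)
    (fun x hx => by rw [sub_neg_eq_add]; exact (hmem x hx).1)
    (Metric.mem_closedBall_self (norm_nonneg h)) (y := e + h)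
    (by rw [mem_closedBall_iff_norm, add_sub_cancel_left])
  rw [add_sub_cancel_left, hS.map_self] at this
  rw [Real.norm_of_nonneg (by positivity)]
  calc _ = ‖S (e + h) - e - (-1 : V →L[ℝ] V) h‖ := by simp
    _ ≤ _ := this
    _ = _ := by ring

theorem isBigO_quadRep_apply_sub_sub (hV : IsOrderUnitSpace V P v) (hS : IsGaugeSymmetry P v S e) :
    (fun h => quadRep S (e + h) e - e - (2 : ℝ) • h) =O[𝓝 0] fun h => ‖h‖ ^ 2 := by
  have h1 : (fun h => (quadRep S (e + h) - 1) (S (e + h) - e)) =O[𝓝 0] fun h => ‖h‖ ^ 2 := by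
    have := (hS.isBigO_quadRep_sub_one hV).norm_norm.mul (hS.isBigO_map_sub hV).norm_norm
    refine Asymptotics.IsBigO.trans (Asymptotics.IsBigO.of_bound 1 ?_) (this.congr_right
      fun h => (sq _).symm)
    filter_upwards with h
    rw [one_mul]
    exact (ContinuousLinearMap.le_opNorm _ _).trans (Real.le_norm_self _)
  refine (h1.add (hS.isBigO_map_sub_add hV)).neg_left.congr' ?_ Filter.EventuallyEq.rfl
  filter_upwards [hS.eventually_add_mem hV] with h hh
  rw [sub_apply, map_sub, hS.quadRep_map_apply hV hh, one_apply_eq_self]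
  module

theorem isBigO_quadRep_two_smul_add (hV : IsOrderUnitSpace V P v) (hS : IsGaugeSymmetry P v S e) :
    (fun p : V × V => (quadRep S (e + ((2 : ℝ) • p.1 + (2 : ℝ) • p.2)) - 1)
      - (2 : ℝ) • (quadRep S (e + p.1) - 1) - (2 : ℝ) • (quadRep S (e + p.2) - 1))
      =O[𝓝 0] fun p => ‖p‖ ^ 2 := by
  have t1 : Filter.Tendsto (fun p : V × V => p.1) (𝓝 0) (𝓝 0) := continuous_fst.tendsto' _ _ rfl
  have t2 : Filter.Tendsto (fun p : V × V => p.2) (𝓝 0) (𝓝 0) := continuous_snd.tendsto' _ _ rfl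
  have t3 : Filter.Tendsto (fun p : V × V => (2 : ℝ) • p.1 + (2 : ℝ) • p.2) (𝓝 0) (𝓝 0) :=
    (by fun_prop : Continuous fun p : V × V => (2 : ℝ) • p.1 + (2 : ℝ) • p.2).tendsto' _ _
      (by simp)
  have g1 : (fun p : V × V => p.1) =O[𝓝 0] fun p => ‖p‖ :=
    .of_bound 1 (.of_forall fun p => by simpa using norm_fst_le p)
  have g2 : (fun p : V × V => p.2) =O[𝓝 0] fun p => ‖p‖ :=
    .of_bound 1 (.of_forall fun p => by simpa using norm_snd_le p)
  have gone : (fun p : V × V => ‖p‖) =O[𝓝 0] fun _ => (1 : ℝ) :=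
    (continuous_norm.tendsto (0 : V × V)).isBigO_one ℝ
  have hA := ((hS.isBigO_quadRep_sub_one hV).comp_tendsto t1).trans g1
  have hB := ((hS.isBigO_quadRep_sub_one hV).comp_tendsto t2).trans g2
  have hSt : Filter.Tendsto (fun h => S (e + h) - e) (𝓝 0) (𝓝 0) :=
    (hS.isBigO_map_sub hV).trans_tendsto Filter.tendsto_id
  have hbd := (hS.tendsto_quadRep hV).isBigO_one ℝ
  have hPa := hbd.comp_tendsto t1
  have hPb := hbd.comp_tendsto t2
  have hPSa := hbd.comp_tendsto (hSt.comp t1)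
  have hPSb := hbd.comp_tendsto (hSt.comp t2)
  have q1 := ((hS.isBigO_quadRep_apply_sub_sub hV).comp_tendsto t1).trans (g1.norm_left.pow 2)
  have q2 := ((hS.isBigO_quadRep_apply_sub_sub hV).comp_tendsto t2).trans (g2.norm_left.pow 2)
  simp only [Function.comp_def, add_sub_cancel] at hA hB hPa hPb hPSa hPSb q1 q2
  have happ : ∀ {T : V × V → V →L[ℝ] V} {z : V × V → V} {f g : V × V → ℝ},
      T =O[𝓝 0] f → z =O[𝓝 0] g → (fun p => T p (z p)) =O[𝓝 0] fun p => f p * g p := by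
    intro T z f g hT hz
    refine Asymptotics.IsBigO.trans (.of_bound 1 (.of_forall fun p => ?_))
      (hT.norm_left.mul hz.norm_left)
    rw [one_mul, norm_mul, norm_norm, norm_norm]
    exact (T p).le_opNorm (z p)
  have hconst : (fun _ : V × V => e) =O[𝓝 0] fun _ => (1 : ℝ) := Asymptotics.isBigO_const_const _ one_ne_zero _
  have q3 := happ hA (happ hB hconst)
  have hR : (fun p : V × V => e + ((2 : ℝ) • p.1 + (2 : ℝ) • p.2)
      - quadRep S (e + p.1) (quadRep S (e + p.2) e)) =O[𝓝 0] fun p => ‖p‖ ^ 2 := by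
    refine ((q1.add q2).add (q3.congr_right fun p => by ring)).neg_left.congr_left fun p => ?_
    simp only [sub_apply, map_sub, one_apply_eq_self]
    abel
  set c : V × V → V := fun p => quadRep S (S (e + p.2)) (quadRep S (S (e + p.1))
    (e + ((2 : ℝ) • p.1 + (2 : ℝ) • p.2))) with hc
  have m1 := t1.eventually (hS.eventually_add_mem hV)
  have m2 := t2.eventually (hS.eventually_add_mem hV)
  have m3 := t3.eventually (hS.eventually_add_mem hV)
  have hce : (fun p => c p - e) =O[𝓝 0] fun p => ‖p‖ ^ 2 := by
    refine ((happ hPSb (happ hPSa hR)).congr' ?_ (.of_forall fun p => by ring))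
    filter_upwards [m1, m2] with p p1 p2
    have e1 : ∀ z, quadRep S (S (e + p.1)) (quadRep S (e + p.1) z) = z := fun z =>
      DFunLike.congr_fun (hS.quadRep_map_mul_quadRep hV p1) z
    have e2 : ∀ z, quadRep S (S (e + p.2)) (quadRep S (e + p.2) z) = z := fun z =>
      DFunLike.congr_fun (hS.quadRep_map_mul_quadRep hV p2) z
    simp only [map_sub, e1, e2, hc]
  have hcet : Filter.Tendsto (fun p => c p - e) (𝓝 0) (𝓝 0) :=
    hce.trans_tendsto ((by fun_prop : Continuous fun p : V × V => ‖p‖ ^ 2).tendsto' _ _ (by simp))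
  have hD := ((hS.isBigO_quadRep_sub_one hV).comp_tendsto hcet).trans hce
  simp only [Function.comp_def, add_sub_cancel] at hD
  have hN : (fun p : V × V => (quadRep S (e + p.2) - 1) * (quadRep S (e + p.2) + 1))
      =O[𝓝 0] fun p => ‖p‖ := by
    simpa using hB.mul (hPb.add (Asymptotics.isBigO_const_const (1 : V →L[ℝ] V) one_ne_zero _))
  have hA1 := hA.trans gone
  have s1 := ((hA.mul hA).add (hB.mul hB)).add ((hA.mul hN).add (hN.mul hA))
  have s2 := (hA.mul hN).mul hA1
  have s3 := (((hPa.mul hPb).mul hD).mul hPb).mul hPa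
  refine ((s1.add (s2.congr_right fun p => by ring)).add (s3.congr_right (g₂ := fun p => ‖p‖ * ‖p‖)
    fun p => by ring)).congr' ?_ (.of_forall fun p => (sq _).symm)
  filter_upwards [m1, m2, m3] with p p1 p2 p3
  have hcm : c p ∈ openCone P v := hS.quadRep_mem_openCone hV (hS.map_mem p2)
    (hS.quadRep_mem_openCone hV (hS.map_mem p1) p3)
  have e1 : ∀ z, quadRep S (e + p.1) (quadRep S (S (e + p.1)) z) = z := fun z =>
    DFunLike.congr_fun (hS.quadRep_mul_quadRep_map hV p1) z
  have e2 : ∀ z, quadRep S (e + p.2) (quadRep S (S (e + p.2)) z) = z := fun z =>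
    DFunLike.congr_fun (hS.quadRep_mul_quadRep_map hV p2) z
  have e3 : e + ((2 : ℝ) • p.1 + (2 : ℝ) • p.2)
      = quadRep S (e + p.1) (quadRep S (e + p.2) (c p)) := by
    simp only [hc, e1, e2]
  rw [e3, hS.quadRep_quadRep hV p1 (hS.quadRep_mem_openCone hV p2 hcm),
    hS.quadRep_quadRep hV p2 hcm, two_smul, two_smul]
  noncomm_ring

theorem exists_hasFDerivAt_quadRep (hV : IsOrderUnitSpace V P v) (hS : IsGaugeSymmetry P v S e) :
    ∃ Λ : V →L[ℝ] V →L[ℝ] V, HasFDerivAt (fun h => quadRep S (e + h)) Λ 0 ∧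
      ∀ h, Λ h e = (2 : ℝ) • h := by
  have key := hS.isBigO_quadRep_two_smul_add hV
  set f : V → V →L[ℝ] V := fun h => quadRep S (e + h) - 1 with hf
  have hf0 : f 0 = 0 := by simp [hf, hS.quadRep_self]
  have t : Filter.Tendsto (fun p : V × V => (2 : ℝ)⁻¹ • p) (𝓝 0) (𝓝 0) :=
    (continuous_const_smul _).tendsto' _ _ (smul_zero _)
  have t1 : Filter.Tendsto (fun p : V × V => ((2 : ℝ)⁻¹ • p.1, (0 : V))) (𝓝 0) (𝓝 0) :=
    (by fun_prop : Continuous fun p : V × V => ((2 : ℝ)⁻¹ • p.1, (0 : V))).tendsto' _ _ (by simp)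
  have t2 : Filter.Tendsto (fun p : V × V => ((2 : ℝ)⁻¹ • p.2, (0 : V))) (𝓝 0) (𝓝 0) :=
    (by fun_prop : Continuous fun p : V × V => ((2 : ℝ)⁻¹ • p.2, (0 : V))).tendsto' _ _ (by simp)
  have hb : ∀ {u : V × V → V × V}, (∀ p, ‖u p‖ ≤ ‖p‖) →
      (fun p => ‖u p‖ ^ 2) =O[𝓝 0] fun p => ‖p‖ ^ 2 := fun hu =>
    .of_bound 1 (.of_forall fun p => by
      simpa using pow_le_pow_left₀ (norm_nonneg _) (hu p) 2)
  have hhalf : ∀ {X : Type _} [NormedAddCommGroup X] [NormedSpace ℝ X] (x : X),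
      ‖(2 : ℝ)⁻¹ • x‖ ≤ ‖x‖ := fun x => by
    rw [norm_smul, Real.norm_of_nonneg (by norm_num)]
    linarith [norm_nonneg x]
  have k0 := (key.comp_tendsto t).trans (hb fun p => hhalf p)
  have k1 := (key.comp_tendsto t1).trans (hb fun p => by
    simpa using (hhalf p.1).trans (norm_fst_le p))
  have k2 := (key.comp_tendsto t2).trans (hb fun p => by
    simpa using (hhalf p.2).trans (norm_snd_le p))
  have hadd : (fun p : V × V => f (p.1 + p.2) - f p.1 - f p.2) =O[𝓝 0] fun p => ‖p‖ ^ 2 := by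
    refine ((k0.sub k1).sub k2).congr_left fun p => ?_
    simp only [Function.comp_apply, Prod.smul_fst, Prod.smul_snd, smul_inv_smul₀ (two_ne_zero' ℝ),
      smul_zero, add_zero]
    simp only [hf, hS.quadRep_self, sub_self, smul_zero]
    abel
  obtain ⟨Λ, hΛ⟩ := exists_hasFDerivAt_zero_of_almost_additive (hS.isBigO_quadRep_sub_one hV) hadd
  refine ⟨Λ, ?_, ?_⟩
  · simpa [hf] using hΛ.add_const 1
  · have h1 : HasFDerivAt (fun h => f h e) (Λ.flip e) 0 := by
      exact ((ContinuousLinearMap.apply ℝ V e).hasFDerivAt.comp 0 hΛ)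
    have h2 : HasFDerivAt (fun h => f h e) ((2 : ℝ) • ContinuousLinearMap.id ℝ V) 0 := by
      refine .of_isLittleO ?_
      refine ((hS.isBigO_quadRep_apply_sub_sub hV).congr_left fun h => ?_).trans_isLittleO ?_
      · simp [hf, hS.quadRep_self]
      · simpa using Asymptotics.isLittleO_norm_pow_id one_lt_two (E' := V)
    intro h
    simpa using DFunLike.congr_fun (h1.unique h2) h

end IsGaugeSymmetry

section Series

variable {E F : Type*} [NormedAddCommGroup E] [NormedSpace ℝ E]
variable [NormedAddCommGroup F] [NormedSpace ℝ F]

theorem AnalyticAt.exists_symmetric_hasFPowerSeriesOnBall [CompleteSpace F] {f : E → F} {x : E}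
    (hf : AnalyticAt ℝ f x) :
    ∃ (p : FormalMultilinearSeries ℝ E F) (r : ENNReal),
      (∀ (k : ℕ) (m : Fin k → E) (σ : Equiv.Perm (Fin k)),
        p k (fun i => m (σ i)) = p k m) ∧
      HasFPowerSeriesOnBall f p x r := by
  obtain ⟨p, r, h⟩ := id hf
  have hp : ∀ (n : ℕ) (m : Fin n → E), ((n.factorial : ℝ)⁻¹ • iteratedFDeriv ℝ n f x) m
      = (n.factorial : ℝ)⁻¹ • ∑ σ : Equiv.Perm (Fin n), p n fun i => m (σ i) := fun n m => by
    rw [smul_apply, h.iteratedFDeriv_eq_sum_of_completeSpace]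
  refine ⟨fun n => (n.factorial : ℝ)⁻¹ • iteratedFDeriv ℝ n f x, r, fun k m σ => ?_, ?_, h.r_pos,
    fun {y} hy => ?_⟩
  · have := hf.contDiffAt.iteratedFDeriv_comp_perm (n := k) m σ
    simp only [smul_apply]
    exact congrArg _ this
  · refine h.r_le.trans (FormalMultilinearSeries.radius_le_of_le fun n => ?_)
    refine ContinuousMultilinearMap.opNorm_le_bound (norm_nonneg _) fun m => ?_
    have hn : (0 : ℝ) < n.factorial := by positivity
    rw [hp, norm_smul, norm_inv, Real.norm_of_nonneg hn.le, inv_mul_le_iff₀ hn]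
    refine (norm_sum_le_of_le _ (f := fun σ : Equiv.Perm (Fin n) => p n fun i => m (σ i))
      (n := fun _ => ‖p n‖ * ∏ i, ‖m i‖) fun σ _ => ?_).trans ?_
    · rw [← Equiv.prod_comp σ]
      exact (p n).le_opNorm _
    · simp [Fintype.card_perm]
  · simpa using h.hasSum_iteratedFDeriv hy

theorem norm_pow_sub_pow_le {A : Type*} [NormedRing A] (h1 : ‖(1 : A)‖ ≤ 1) {a b : A} {M : ℝ}
    (hM : 1 ≤ M) (ha : ‖a‖ ≤ M) (hb : ‖b‖ ≤ M) (n : ℕ) :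
    ‖a ^ n - b ^ n‖ ≤ n * M ^ n * ‖a - b‖ := by
  have hpow : ∀ n, ‖a ^ n‖ ≤ M ^ n := by
    intro n
    rcases n.eq_zero_or_pos with rfl | hn
    · simpa using h1
    · exact (norm_pow_le' a hn).trans (pow_le_pow_left₀ (norm_nonneg _) ha n)
  induction n with
  | zero => simp
  | succ n ih =>
    have h2 : a ^ (n + 1) - b ^ (n + 1) = a ^ n * (a - b) + (a ^ n - b ^ n) * b := by
      rw [pow_succ, pow_succ]; noncomm_ring
    have h3 : ‖a ^ n * (a - b)‖ ≤ M ^ (n + 1) * ‖a - b‖ := by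
      refine (norm_mul_le _ _).trans ?_
      gcongr
      exact (hpow n).trans (pow_le_pow_right₀ hM n.le_succ)
    have h4 : ‖(a ^ n - b ^ n) * b‖ ≤ n * M ^ n * ‖a - b‖ * M := by
      refine (norm_mul_le _ _).trans ?_
      gcongr
    rw [h2]
    refine (norm_add_le_of_le h3 h4).trans_eq ?_
    push_cast
    ring

theorem tendsto_pow_exp {A : Type*} [NormedRing A] [NormedAlgebra ℝ A] [CompleteSpace A]
    (h1 : ‖(1 : A)‖ ≤ 1) {g : ℝ → A} {Y : A} (hg : HasDerivAt g Y 0) (hg0 : g 0 = 1) :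
    Filter.Tendsto (fun n : ℕ => g (n : ℝ)⁻¹ ^ n) Filter.atTop (𝓝 (NormedSpace.exp Y)) := by
  let : NormedAlgebra ℚ A := NormedAlgebra.restrictScalars ℚ ℝ A
  set h : ℝ → A := fun t => NormedSpace.exp (t • Y) with hh
  have hd : HasDerivAt h Y 0 := by
    simpa using hasDerivAt_exp_smul_const (𝕂 := ℝ) Y 0
  have hh0 : h 0 = 1 := by simp [hh]
  have ht : Filter.Tendsto (fun n : ℕ => (n : ℝ)⁻¹) Filter.atTop (𝓝 0) :=
    tendsto_inv_atTop_nhds_zero_nat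
  have hbound : ∀ {u : ℝ → A}, HasDerivAt u Y 0 → u 0 = 1 →
      ∃ K, ∀ᶠ n : ℕ in Filter.atTop, ‖u (n : ℝ)⁻¹‖ ≤ Real.exp (K * (n : ℝ)⁻¹) := by
    intro u hu hu0
    obtain ⟨K, hK⟩ := hu.isBigO_sub.bound
    refine ⟨K, (ht.eventually hK).mono fun n hn => ?_⟩
    rw [hu0, sub_zero, Real.norm_of_nonneg (by positivity)] at hn
    have h2 := norm_le_norm_sub_add (u (n : ℝ)⁻¹) 1
    linarith [Real.add_one_le_exp (K * (n : ℝ)⁻¹)]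
  obtain ⟨K₁, hK₁⟩ := hbound hg hg0
  obtain ⟨K₂, hK₂⟩ := hbound hd hh0
  set K := max 0 (max K₁ K₂) with hK
  have hlim : Filter.Tendsto (fun n : ℕ => Real.exp K * (n * ‖g (n : ℝ)⁻¹ - h (n : ℝ)⁻¹‖))
      Filter.atTop (𝓝 0) := by
    have h3 : HasDerivAt (fun t => g t - h t) 0 0 := by
      rw [← sub_self Y]; exact hg.sub hd
    have h4 := (h3.isLittleO.comp_tendsto ht).tendsto_inv_smul_nhds_zero
    rw [← mul_zero (Real.exp K)]
    refine Filter.Tendsto.const_mul _ (h4.norm.congr fun n => ?_) |>.trans_eq ?_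
    all_goals simp [norm_smul, hg0, hh0]
  have hdiff : Filter.Tendsto (fun n : ℕ => g (n : ℝ)⁻¹ ^ n - h (n : ℝ)⁻¹ ^ n)
      Filter.atTop (𝓝 0) := by
    refine squeeze_zero_norm' ?_ hlim
    filter_upwards [hK₁, hK₂, Filter.eventually_ge_atTop 1] with n n1 n2 n3
    have hn : (0 : ℝ) < n := by exact_mod_cast n3
    have hM : ∀ {c}, c ≤ K → Real.exp (c * (n : ℝ)⁻¹) ≤ Real.exp (K * (n : ℝ)⁻¹) := fun hc =>
      Real.exp_le_exp.2 (mul_le_mul_of_nonneg_right hc (by positivity))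
    refine (norm_pow_sub_pow_le h1 (M := Real.exp (K * (n : ℝ)⁻¹)) (Real.one_le_exp (by positivity))
      (n1.trans (hM (by simp [hK]))) (n2.trans (hM (by simp [hK]))) n).trans_eq ?_
    rw [← Real.exp_nat_mul, mul_comm K, mul_inv_cancel_left₀ hn.ne']
    ring
  have hexp : ∀ᶠ n : ℕ in Filter.atTop, h (n : ℝ)⁻¹ ^ n = NormedSpace.exp Y := by
    filter_upwards [Filter.eventually_ge_atTop 1] with n n3
    have hn : (n : ℝ) ≠ 0 := by positivity
    rw [hh, ← NormedSpace.exp_nsmul, ← Nat.cast_smul_eq_nsmul ℝ, smul_inv_smul₀ hn]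
  have := hdiff.add (tendsto_const_nhds (x := NormedSpace.exp Y))
  rw [zero_add] at this
  refine this.congr' ?_
  filter_upwards [hexp] with n hn
  rw [hn, sub_add_cancel]

theorem AnalyticAt.exists_local_inverse [CompleteSpace E] {f : E → F} {x : E}
    {i : E ≃L[ℝ] F} (hf : AnalyticAt ℝ f x) (hi : HasFDerivAt f (i : E →L[ℝ] F) x) :
    ∃ g : F → E, AnalyticAt ℝ g (f x) ∧ g (f x) = x ∧ ∀ᶠ y in 𝓝 (f x), f (g y) = y := by
  have hfd : HasStrictFDerivAt f (i : E →L[ℝ] F) x := hi.fderiv ▸ hf.hasStrictFDerivAt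
  obtain ⟨p, hp⟩ := id hf
  have hx := hfd.mem_toOpenPartialHomeomorph_source
  refine ⟨hfd.localInverse f i x, ?_, hfd.localInverse_apply_image, hfd.eventually_right_inverse⟩
  refine ((hfd.toOpenPartialHomeomorph f).hasFPowerSeriesAt_symm hx hp (i := i) ?_).analyticAt
  have h1 := hp.hasFDerivAt.unique hi
  rw [← h1]
  simp

end Series

namespace IsGaugeSymmetry

variable {V : Type*} [NormedAddCommGroup V] [NormedSpace ℝ V] {P : Set V} {v : V}
variable [CompleteSpace V] {S : V → V} {e : V}

theorem map_exp_apply (hV : IsOrderUnitSpace V P v) (hS : IsGaugeSymmetry P v S e)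
    {Λ : V →L[ℝ] V →L[ℝ] V} (hΛ : HasFDerivAt (fun h => quadRep S (e + h)) Λ 0) {h : V}
    (hmem : NormedSpace.exp (Λ h) e ∈ openCone P v) :
    S (NormedSpace.exp (Λ h) e) = NormedSpace.exp (Λ (-h)) e := by
  have hline : HasDerivAt (fun t : ℝ => t • h) h 0 := by
    simpa using (hasDerivAt_id (0 : ℝ)).smul_const h
  have ht : Filter.Tendsto (fun n : ℕ => (n : ℝ)⁻¹ • h) Filter.atTop (𝓝 0) := by
    have := (tendsto_inv_atTop_nhds_zero_nat (𝕜 := ℝ)).smul_const h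
    rwa [zero_smul] at this
  have hone : ‖(1 : V →L[ℝ] V)‖ ≤ 1 := ContinuousLinearMap.norm_id_le
  have happly : ∀ {u : ℕ → V →L[ℝ] V} {T : V →L[ℝ] V},
      Filter.Tendsto u Filter.atTop (𝓝 T) → Filter.Tendsto (fun n => u n e) Filter.atTop (𝓝 (T e)) :=
    fun hu => ((ContinuousLinearMap.apply ℝ V e).continuous.tendsto _).comp hu
  have hS1 : HasDerivAt (fun t : ℝ => S (e + t • h) - e) (-h) 0 := by
    have h1 : HasFDerivAt S (-ContinuousLinearMap.id ℝ V) (e + (0 : ℝ) • h) := by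
      rw [zero_smul, add_zero, ← hS.fderiv_eq]
      exact (hS.gaugeReversing.differentiableAt hV hV hS.mem).hasFDerivAt
    simpa using (h1.comp_hasDerivAt 0 (hline.const_add e)).sub_const e
  have l1 : Filter.Tendsto (fun n : ℕ => quadRep S (e + (n : ℝ)⁻¹ • h) ^ n) Filter.atTop
      (𝓝 (NormedSpace.exp (Λ h))) := by
    refine tendsto_pow_exp hone (g := fun t : ℝ => quadRep S (e + t • h)) ?_
      (by simp [hS.quadRep_self])
    rw [← zero_smul ℝ h] at hΛ
    exact hΛ.comp_hasDerivAt 0 hline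
  have l2 : Filter.Tendsto (fun n : ℕ => quadRep S (S (e + (n : ℝ)⁻¹ • h)) ^ n) Filter.atTop
      (𝓝 (NormedSpace.exp (Λ (-h)))) := by
    refine tendsto_pow_exp hone (g := fun t : ℝ => quadRep S (S (e + t • h))) ?_
      (by simp [hS.map_self, hS.quadRep_self])
    have h0 : (fun t : ℝ => S (e + t • h) - e) 0 = 0 := by simp [hS.map_self]
    rw [← h0] at hΛ
    have := hΛ.comp_hasDerivAt 0 hS1
    simpa [Function.comp_def] using this
  refine tendsto_nhds_unique (((hS.continuousAt hV hmem).tendsto.comp (happly l1)).congr' ?_)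
    (happly l2)
  filter_upwards [ht.eventually (hS.eventually_add_mem hV)] with n hn
  exact hS.map_quadRep_pow hV hn n

theorem analyticAt (hV : IsOrderUnitSpace V P v) (hS : IsGaugeSymmetry P v S e) :
    AnalyticAt ℝ S e := by
  obtain ⟨Λ, hΛ, hΛe⟩ := hS.exists_hasFDerivAt_quadRep hV
  set F : V → V := fun h => NormedSpace.exp (Λ h) e with hF
  have hF0 : F 0 = e := by simp [hF]
  have hFa : ∀ h, AnalyticAt ℝ F h := fun h =>
    ((ContinuousLinearMap.apply ℝ V e).analyticAt _).comp
      ((NormedSpace.exp_analytic (𝕂 := ℝ) _).comp (Λ.analyticAt h))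
  let i : V ≃L[ℝ] V := ContinuousLinearEquiv.smulLeft (Units.mk0 (2 : ℝ) two_ne_zero)
  have hFd : HasFDerivAt F (i : V →L[ℝ] V) 0 := by
    have h1 : HasFDerivAt (NormedSpace.exp : (V →L[ℝ] V) → V →L[ℝ] V)
        (1 : (V →L[ℝ] V) →L[ℝ] (V →L[ℝ] V)) (Λ 0) := by
      rw [map_zero]; exact hasFDerivAt_exp_zero
    have h2 := (ContinuousLinearMap.apply ℝ V e).hasFDerivAt.comp 0 (h1.comp 0 Λ.hasFDerivAt)
    convert! h2 using 1
    ext h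
    exact (hΛe h).symm
  obtain ⟨G, hGa, hG0, hG⟩ := (hFa 0).exists_local_inverse hFd
  rw [hF0] at hGa hG0 hG
  have hcomp : AnalyticAt ℝ (fun y => F (-G y)) e := AnalyticAt.comp (hFa _) hGa.neg
  refine hcomp.congr ?_
  filter_upwards [hG, hV.isOpen_openCone.mem_nhds hS.mem] with y hy hyC
  rw [← hy] at hyC
  have := hS.map_exp_apply hV hΛ hyC
  exact this.symm.trans (congrArg S hy)

end IsGaugeSymmetry

theorem GaugeReversing.analyticAt {V : Type*} [NormedAddCommGroup V] [NormedSpace ℝ V]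
    [CompleteSpace V] {W : Type*} [NormedAddCommGroup W] [NormedSpace ℝ W] [CompleteSpace W]
    {P : Set V} {v : V} {Q : Set W} {w : W} (hV : IsOrderUnitSpace V P v)
    (hW : IsOrderUnitSpace W Q w) {Φ : V → W} (hΦ : GaugeReversing P v Q w Φ) {x : V}
    (hx : x ∈ openCone P v) : AnalyticAt ℝ Φ x := by
  obtain ⟨T, -, -, -, hS⟩ := hΦ.exists_isGaugeSymmetry hV hW hx
  have := (T.symm.toContinuousLinearMap.analyticAt _).comp (hS.analyticAt hV)
  simpa [Function.comp_def] using this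

/-- A gauge-reversing bijection `Φ` between the open cones of two
complete order unit spaces is analytic: at every point `x` of the open cone, `Φ` admits
a convergent power series expansion whose terms are continuous symmetric multilinear
maps. -/
theorem gaugeReversing_analytic
    {V : Type*} [NormedAddCommGroup V] [NormedSpace ℝ V] [CompleteSpace V]
    {W : Type*} [NormedAddCommGroup W] [NormedSpace ℝ W] [CompleteSpace W]
    (P : Set V) (v : V) (Q : Set W) (w : W)
    (hV : IsOrderUnitSpace V P v) (hW : IsOrderUnitSpace W Q w)
    (Φ : V → W) (hΦ : GaugeReversing P v Q w Φ) :
    ∀ x ∈ openCone P v, ∃ (p : FormalMultilinearSeries ℝ V W) (r : ENNReal),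
      (∀ (k : ℕ) (m : Fin k → V) (σ : Equiv.Perm (Fin k)),
        p k (fun i => m (σ i)) = p k m) ∧
      HasFPowerSeriesOnBall Φ p x r :=
  fun _ hx => (hΦ.analyticAt hV hW hx).exists_symmetric_hasFPowerSeriesOnBall
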